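/- Let F be a number field with [F:ℚ] ≥ 2, let n ≥ 5 be an integer, and let ε > 0. Then there exists a constant C = C(F,n,ε) > 0 such that for every number field K of degree n over ℚ which admits a ℚ-algebra embedding F ↪ K, one has #h₂(K) ≤ C · D_K^{1/2 − 2/(3n) + ε}. -/

import Mathlib

open NumberField


open scoped Classical in
lemma vol_fund_le (K : Type) [Field K] [NumberField K]
    (I : (FractionalIdeal (nonZeroDivisors (𝓞 K)) K)ˣ) :
    MeasureTheory.volume (ZSpan.fundamentalDomain (mixedEmbedding.fractionalIdealLatticeBasis K I)) ≤
      ENNReal.ofReal ((FractionalIdeal.absNorm I.1 : ℝ) * Real.sqrt |(discr K : ℝ)|) := by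
  rw [mixedEmbedding.volume_fundamentalDomain_fractionalIdealLatticeBasis,
      mixedEmbedding.volume_fundamentalDomain_latticeBasis]
  have h0 : (0 : ℝ) ≤ (FractionalIdeal.absNorm I.1 : ℝ) := by
    exact_mod_cast FractionalIdeal.absNorm_nonneg I.1
  rw [ENNReal.ofReal_mul h0]
  gcongr
  have h1 : ((NNReal.sqrt ‖discr K‖₊ : NNReal) : ENNReal) =
      ENNReal.ofReal (Real.sqrt |(discr K : ℝ)|) := by
    rw [← ENNReal.ofReal_coe_nnreal]
    congr 1
    rw [Real.coe_sqrt, coe_nnnorm, Int.norm_eq_abs]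
    try push_cast
    try rfl
  rw [h1]
  calc _ ≤ 1 * ENNReal.ofReal (Real.sqrt |(discr K : ℝ)|) := by
        gcongr
        apply pow_le_one₀ (by simp)
        simp
    _ = _ := one_mul _

lemma prod_place_eq (K : Type) [Field K] [NumberField K] (r : ℝ) :
    ∏ w : InfinitePlace K, r ^ w.mult = r ^ (Module.finrank ℚ K) := by
  rw [Finset.prod_pow_eq_pow_sum, InfinitePlace.sum_mult_eq]

open scoped Classical in
lemma hvol_aux (K : Type) [Field K] [NumberField K] (J₀ : nonZeroDivisors (Ideal (𝓞 K)))
    (β : 𝓞 K) (hβ' : (J₀ : Ideal (𝓞 K)) ^ 2 = Ideal.span {β}) (R : ℝ) (hR : 0 ≤ R)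
    (f : InfinitePlace K → NNReal) (hf : ∀ w, (f w : ℝ) = Real.sqrt (w (β : K)) * Real.sqrt R)
    (hRn : R ^ (Module.finrank ℚ K) = (4 : ℝ) ^ (Module.finrank ℚ K + 1) * |(discr K : ℝ)|) :
    mixedEmbedding.minkowskiBound K (FractionalIdeal.mk0 K J₀) <
      MeasureTheory.volume (mixedEmbedding.convexBodyLT K f) := by
  have hJne : (J₀ : Ideal (𝓞 K)) ≠ 0 := nonZeroDivisors.ne_zero J₀.2
  have hD : 0 < |(discr K : ℝ)| := by simpa using discr_ne_zero K
  set N : ℝ := (Ideal.absNorm (J₀ : Ideal (𝓞 K)) : ℝ) with hN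
  have hNpos : 0 < N := by
    have : Ideal.absNorm (J₀ : Ideal (𝓞 K)) ≠ 0 := by
      rw [Ne, Ideal.absNorm_eq_zero_iff]; exact hJne
    positivity
  have hNsq : N ^ 2 = |(Algebra.norm ℚ (β : K) : ℝ)| := by
    have h1 := congrArg Ideal.absNorm hβ'
    rw [map_pow, Ideal.absNorm_span_singleton] at h1
    have h2 : (N : ℝ) ^ 2 = ((Algebra.norm ℤ β).natAbs : ℝ) := by rw [hN]; exact_mod_cast h1
    rw [h2, Nat.cast_natAbs, ← Algebra.coe_norm_int]
    simp
  rw [mixedEmbedding.convexBodyLT_volume, mixedEmbedding.minkowskiBound, mixedEmbedding.finrank]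
  have h1 : (∏ w : InfinitePlace K, (Real.sqrt (w (β : K)) * Real.sqrt R) ^ w.mult) =
      N * (2 ^ (Module.finrank ℚ K + 1) * Real.sqrt |(discr K : ℝ)|) := by
    simp_rw [mul_pow]
    rw [Finset.prod_mul_distrib, prod_place_eq]
    congr 1
    · rw [← sq_eq_sq₀ (by positivity) hNpos.le, hNsq, ← Finset.prod_pow, ← Rat.cast_abs,
        ← InfinitePlace.prod_eq_abs_norm]
      refine Finset.prod_congr rfl fun w _ => ?_
      rw [← pow_mul, mul_comm w.mult, pow_mul, Real.sq_sqrt (apply_nonneg _ _)]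
    · rw [← sq_eq_sq₀ (by positivity) (by positivity), ← pow_mul, mul_comm _ 2, pow_mul,
        Real.sq_sqrt hR, hRn, mul_pow, Real.sq_sqrt hD.le, ← pow_mul, mul_comm _ 2, pow_mul]
      norm_num
  have h2 : ENNReal.ofReal (N * (2 ^ (Module.finrank ℚ K + 1) * Real.sqrt |(discr K : ℝ)|)) =
      ((∏ w : InfinitePlace K, (f w) ^ w.mult : NNReal) : ENNReal) := by
    rw [← ENNReal.ofReal_coe_nnreal, ← h1]
    congr 1
    push_cast
    simp_rw [hf]
  calc _ ≤ ENNReal.ofReal (N * Real.sqrt |(discr K : ℝ)|) * 2 ^ (Module.finrank ℚ K) := by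
        gcongr
        refine (vol_fund_le K _).trans (le_of_eq ?_)
        rw [FractionalIdeal.coe_mk0, FractionalIdeal.coeIdeal_absNorm]
        simp [hN]
    _ = ENNReal.ofReal (N * Real.sqrt |(discr K : ℝ)| * 2 ^ (Module.finrank ℚ K)) := by
        rw [ENNReal.ofReal_mul (p := N * _) (by positivity), ENNReal.ofReal_pow (by norm_num)]
        simp
    _ < ENNReal.ofReal (N * (2 ^ (Module.finrank ℚ K + 1) * Real.sqrt |(discr K : ℝ)|)) := by
        rw [ENNReal.ofReal_lt_ofReal_iff (by positivity), pow_succ]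
        have : 0 < N * Real.sqrt |(discr K : ℝ)| * 2 ^ (Module.finrank ℚ K) := by positivity
        linarith
    _ = 1 * _ := by rw [one_mul, h2]
    _ ≤ _ := by
        gcongr
        exact_mod_cast mixedEmbedding.one_le_convexBodyLTFactor K

/-- The box radius: `B ^ n = 4 ^ (n+1) * D`. -/
noncomputable def boxR (K : Type) [Field K] [NumberField K] : ℝ :=
  ((4 : ℝ) ^ (Module.finrank ℚ K + 1) * |(discr K : ℝ)|) ^ ((1 : ℝ) / (Module.finrank ℚ K : ℝ))

lemma one_le_abs_discr (K : Type) [Field K] [NumberField K] : (1 : ℝ) ≤ |(discr K : ℝ)| := by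
  have h : (1 : ℤ) ≤ |discr K| := Int.one_le_abs (discr_ne_zero K)
  exact_mod_cast h

lemma boxR_pow (K : Type) [Field K] [NumberField K] :
    boxR K ^ (Module.finrank ℚ K) = (4 : ℝ) ^ (Module.finrank ℚ K + 1) * |(discr K : ℝ)| := by
  unfold boxR
  rw [← Real.rpow_natCast, ← Real.rpow_mul (by positivity), one_div, inv_mul_cancel₀, Real.rpow_one]
  have : 0 < Module.finrank ℚ K := Module.finrank_pos
  positivity

lemma boxR_pos (K : Type) [Field K] [NumberField K] : 0 < boxR K := by
  have := one_le_abs_discr K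
  unfold boxR
  positivity

lemma one_le_boxR (K : Type) [Field K] [NumberField K] : 1 ≤ boxR K := by
  have h := one_le_abs_discr K
  unfold boxR
  apply Real.one_le_rpow
  · have : (1 : ℝ) ≤ (4 : ℝ) ^ (Module.finrank ℚ K + 1) := one_le_pow₀ (by norm_num)
    nlinarith
  · positivity

/-- Each 2-torsion class is represented by `J` with `J ^ 2 = (α)`, `α` in the box. -/
lemma exists_rep (K : Type) [Field K] [NumberField K] (c : ClassGroup (𝓞 K)) (hc : c ^ 2 = 1) :
    ∃ (J : nonZeroDivisors (Ideal (𝓞 K))) (α : 𝓞 K), ClassGroup.mk0 J = c ∧ α ≠ 0 ∧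
      (J : Ideal (𝓞 K)) ^ 2 = Ideal.span {α} ∧ ∀ w : InfinitePlace K, w (α : K) ≤ boxR K := by
  classical
  obtain ⟨J₀, hJ₀⟩ := ClassGroup.mk0_surjective c
  have h1 : ClassGroup.mk0 (J₀ ^ 2) = 1 := by rw [map_pow, hJ₀, hc]
  rw [ClassGroup.mk0_eq_one_iff] at h1
  obtain ⟨β, hβ⟩ := h1.principal
  have hβ' : (J₀ : Ideal (𝓞 K)) ^ 2 = Ideal.span {β} := by simpa using hβ
  have hJne : (J₀ : Ideal (𝓞 K)) ≠ 0 := nonZeroDivisors.ne_zero J₀.2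
  have hβ0 : β ≠ 0 := by
    rintro rfl
    apply hJne
    have : (J₀ : Ideal (𝓞 K)) ^ 2 = 0 := by rw [hβ']; simp
    exact pow_eq_zero_iff (two_ne_zero) |>.mp this
  set n := Module.finrank ℚ K with hn
  have hnpos : 0 < n := Module.finrank_pos
  set D : ℝ := |(discr K : ℝ)| with hD
  have hD1 : 1 ≤ D := one_le_abs_discr K
  let f : InfinitePlace K → NNReal := fun w =>
    ⟨Real.sqrt (w (β : K)) * Real.sqrt (boxR K), by positivity⟩
  let I : (FractionalIdeal (nonZeroDivisors (𝓞 K)) K)ˣ :=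
    FractionalIdeal.mk0 K J₀
  have hvol : mixedEmbedding.minkowskiBound K I <
      MeasureTheory.volume (mixedEmbedding.convexBodyLT K f) := by
    exact hvol_aux K J₀ β hβ' (boxR K) (boxR_pos K).le f (fun _ => rfl) (boxR_pow K)
  obtain ⟨κ, hκI, hκ0, hκ⟩ := mixedEmbedding.exists_ne_zero_mem_ideal_lt K I hvol
  obtain ⟨κ', hκ', rfl⟩ : ∃ x ∈ (J₀ : Ideal (𝓞 K)), algebraMap (𝓞 K) K x = κ := by
    simpa [I, FractionalIdeal.mem_coeIdeal] using hκI
  have hκ'0 : κ' ≠ 0 := by rintro rfl; simp at hκ0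
  have hsq : κ' ^ 2 ∈ Ideal.span {β} := by rw [← hβ']; exact Ideal.pow_mem_pow hκ' 2
  obtain ⟨α, hα⟩ := Ideal.mem_span_singleton.mp hsq
  obtain ⟨J, hJ⟩ := Ideal.dvd_span_singleton.mpr hκ'
  have hJ0 : J ≠ 0 := by
    rintro rfl
    simp at hJ
    exact hκ'0 hJ
  have hα0 : α ≠ 0 := by
    rintro rfl
    simp at hα
    exact hκ'0 hα
  refine ⟨⟨J, mem_nonZeroDivisors_of_ne_zero hJ0⟩, α, ?_, hα0, ?_, ?_⟩
  · have : c * ClassGroup.mk0 ⟨J, mem_nonZeroDivisors_of_ne_zero hJ0⟩ = 1 := by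
      rw [← hJ₀, ← map_mul, ClassGroup.mk0_eq_one_iff]
      exact ⟨κ', by simpa using hJ.symm⟩
    have h2 : c * c = 1 := by rw [← sq, hc]
    exact mul_left_cancel (this.trans h2.symm)
  · have : (J₀ : Ideal (𝓞 K)) ^ 2 * J ^ 2 = (J₀ : Ideal (𝓞 K)) ^ 2 * Ideal.span {α} := by
      rw [← mul_pow, ← hJ, hβ', Ideal.span_singleton_pow, hα, Ideal.span_singleton_mul_span_singleton]
    exact mul_left_cancel₀ (pow_ne_zero 2 hJne) this
  · intro w
    have h1 := hκ w
    have h2 : w (algebraMap (𝓞 K) K κ') ^ 2 = w (β : K) * w (α : K) := by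
      rw [← map_pow, ← map_mul, ← map_pow, hα, map_mul]
    have h3 : w (algebraMap (𝓞 K) K κ') ^ 2 ≤ w (β : K) * boxR K := by
      have h4 : w (algebraMap (𝓞 K) K κ') ≤ Real.sqrt (w (β : K)) * Real.sqrt (boxR K) := h1.le
      calc _ ≤ (Real.sqrt (w (β : K)) * Real.sqrt (boxR K)) ^ 2 :=
            pow_le_pow_left₀ (apply_nonneg _ _) h4 2
        _ = _ := by rw [mul_pow, Real.sq_sqrt (apply_nonneg _ _), Real.sq_sqrt (boxR_pos K).le]
    have hβw : 0 < w (β : K) := by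
      rw [InfinitePlace.pos_iff]; simpa using hβ0
    rw [h2] at h3
    exact le_of_mul_le_mul_left h3 hβw


section abstractCount
open MeasureTheory
open scoped Pointwise

variable {E : Type*} [NormedAddCommGroup E] [NormedSpace ℝ E] [MeasurableSpace E] [BorelSpace E]
  [FiniteDimensional ℝ E] (μ : Measure E) [μ.IsAddHaarMeasure] {ι : Type*} [Fintype ι]
  (b : Module.Basis ι ℝ E)

lemma integral_cos_zero (ψ : E → ℝ) (hψc : Continuous ψ)
    (hψ : ∀ x y, ψ (x + y) = ψ x + ψ y)
    (hΛ : ∀ x ∈ Submodule.span ℤ (Set.range b), ∃ k : ℤ, ψ x = k)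
    (y₀ : E) (hy₀ : ψ y₀ = 1 / 2) :
    ∫ y in ZSpan.fundamentalDomain b, Real.cos (2 * Real.pi * ψ y) ∂μ = 0 := by
  have hF := ZSpan.isAddFundamentalDomain' b μ
  have : Countable (Submodule.span ℤ (Set.range b)).toAddSubgroup := by
    change Countable (Submodule.span ℤ (Set.range b))
    infer_instance
  have hF2 := hF.vadd_of_comm y₀
  have h1 := hF.setIntegral_eq hF2 (f := fun y => Real.cos (2 * Real.pi * ψ y)) (by
    rintro ⟨g, hg⟩ x
    obtain ⟨k, hk⟩ := hΛ g hg
    change Real.cos (2 * Real.pi * ψ (g + x)) = _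
    rw [hψ, hk, mul_add, add_comm, mul_comm (2 * Real.pi) (k : ℝ), Real.cos_add_int_mul_two_pi])
  have h2 : ∫ y in y₀ +ᵥ ZSpan.fundamentalDomain b, Real.cos (2 * Real.pi * ψ y) ∂μ =
      ∫ y in ZSpan.fundamentalDomain b, Real.cos (2 * Real.pi * ψ (y₀ + y)) ∂μ :=
    (measurePreserving_add_left μ y₀).setIntegral_image_emb (measurableEmbedding_addLeft y₀) _ _
  have h3 : ∀ y, Real.cos (2 * Real.pi * ψ (y₀ + y)) = - Real.cos (2 * Real.pi * ψ y) := by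
    intro y
    rw [hψ, hy₀, ← Real.cos_add_pi]
    congr 1
    ring
  simp_rw [h3] at h2
  rw [integral_neg] at h2
  rw [h2] at h1
  linarith

lemma lintegral_le_of_inj (A : Set E) (hA : MeasurableSet A)
    (hinj : ∀ x ∈ A, ∀ y ∈ A, x - y ∈ Submodule.span ℤ (Set.range b) → x = y)
    (f : E → ENNReal) (hf : ∀ g ∈ Submodule.span ℤ (Set.range b), ∀ x, f (g + x) = f x) :
    ∫⁻ y in A, f y ∂μ ≤ ∫⁻ y in ZSpan.fundamentalDomain b, f y ∂μ := by
  have hF := ZSpan.isAddFundamentalDomain' b μ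
  have : Countable (Submodule.span ℤ (Set.range b)).toAddSubgroup := by
    change Countable (Submodule.span ℤ (Set.range b))
    infer_instance
  rw [hF.setLIntegral_eq_tsum' f A]
  have h1 : ∀ g : (Submodule.span ℤ (Set.range b)).toAddSubgroup, ∀ x, f (-g +ᵥ x) = f x := by
    intro g x
    exact hf _ (neg_mem g.2) x
  simp_rw [h1]
  rw [← lintegral_iUnion]
  · apply lintegral_mono_set
    exact Set.iUnion_subset fun g => Set.inter_subset_right
  · intro g
    refine MeasurableSet.inter ?_ (ZSpan.fundamentalDomain_measurableSet b)
    exact hA.const_vadd (g : E)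
  · intro g g' hgg'
    rw [Function.onFun, Set.disjoint_left]
    rintro x ⟨⟨u, hu, rfl⟩, -⟩ ⟨⟨v, hv, hv'⟩, -⟩
    apply hgg'
    have h : (g' : E) + v = (g : E) + u := hv'
    have h5 : u - v ∈ Submodule.span ℤ (Set.range b) := by
      have : u - v = (g' : E) - g := by
        rw [sub_eq_sub_iff_add_eq_add, add_comm u, ← h]
      rw [this]
      exact sub_mem g'.2 g.2
    have h6 := hinj u hu v hv h5
    subst h6
    exact (Subtype.ext (add_right_cancel h)).symm

lemma count_abstract {G : Type*} [AddCommGroup G] (S : Finset G) (φ : G → E → ℝ)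
    (hc : ∀ a, Continuous (φ a)) (hadd : ∀ a x y, φ a (x + y) = φ a x + φ a y)
    (hsub : ∀ a a' x, φ (a - a') x = φ a x - φ a' x)
    (hΛ : ∀ a, ∀ x ∈ Submodule.span ℤ (Set.range b), ∃ k : ℤ, φ a x = k)
    (hhalf : ∀ a, a ≠ 0 → ∃ y, φ a y = 1 / 2)
    (A : Set E) (hA : MeasurableSet A)
    (hinj : ∀ x ∈ A, ∀ y ∈ A, x - y ∈ Submodule.span ℤ (Set.range b) → x = y)
    (hsmall : ∀ a ∈ S, ∀ y ∈ A, |φ a y| ≤ 1 / 6) :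
    (S.card : ENNReal) * μ A ≤ 4 * μ (ZSpan.fundamentalDomain b) := by
  classical
  rcases S.eq_empty_or_nonempty with rfl | hne
  · simp
  have hfin : μ (ZSpan.fundamentalDomain b) < ⊤ :=
    (ZSpan.fundamentalDomain_isBounded b).measure_lt_top
  set f : E → ℝ := fun y => ∑ a ∈ S, ∑ a' ∈ S, Real.cos (2 * Real.pi * φ (a - a') y) with hf
  have hf2 : ∀ y, f y = (∑ a ∈ S, Real.cos (2 * Real.pi * φ a y)) ^ 2 +
      (∑ a ∈ S, Real.sin (2 * Real.pi * φ a y)) ^ 2 := by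
    intro y
    rw [sq, sq, Finset.sum_mul_sum, Finset.sum_mul_sum, ← Finset.sum_add_distrib]
    refine Finset.sum_congr rfl fun a _ => ?_
    rw [← Finset.sum_add_distrib]
    refine Finset.sum_congr rfl fun a' _ => ?_
    rw [hsub, mul_sub, Real.cos_sub]
  have hf0 : ∀ y, 0 ≤ f y := fun y => by rw [hf2]; positivity
  have hfc : Continuous f := by
    simp only [hf]
    refine continuous_finsetSum _ fun a _ => continuous_finsetSum _ fun a' _ => ?_
    exact Real.continuous_cos.comp (continuous_const.mul (hc _))
  have hcosint : ∀ a, IntegrableOn (fun y => Real.cos (2 * Real.pi * φ a y))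
      (ZSpan.fundamentalDomain b) μ := by
    intro a
    refine Measure.integrableOn_of_bounded hfin.ne (M := 1) ?_ ?_
    · exact (Real.continuous_cos.comp (continuous_const.mul (hc a))).aestronglyMeasurable
    · exact Filter.Eventually.of_forall fun y => by
        rw [Real.norm_eq_abs]; exact Real.abs_cos_le_one _
  have hint : ∫ y in ZSpan.fundamentalDomain b, f y ∂μ =
      S.card * (μ (ZSpan.fundamentalDomain b)).toReal := by
    simp only [hf]
    rw [integral_finsetSum _ (fun a _ => integrable_finsetSum _ fun a' _ => hcosint _)]
    rw [← nsmul_eq_mul, ← Finset.sum_const]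
    refine Finset.sum_congr rfl fun a ha => ?_
    rw [integral_finsetSum _ (fun a' _ => hcosint _), Finset.sum_eq_single a]
    · have : ∀ y, φ (a - a) y = 0 := fun y => by rw [hsub, sub_self]
      simp only [this]
      simp [measureReal_def]
    · intro a' _ hne
      obtain ⟨y₀, hy₀⟩ := hhalf (a - a') (sub_ne_zero.mpr hne.symm)
      exact integral_cos_zero μ b _ (hc _) (hadd _) (hΛ _) y₀ hy₀
    · exact fun h => (h ha).elim
  have hfint : IntegrableOn f (ZSpan.fundamentalDomain b) μ :=
    integrable_finsetSum _ fun a _ => integrable_finsetSum _ fun a' _ => hcosint _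
  have h1 := lintegral_le_of_inj μ b A hA hinj (fun y => ENNReal.ofReal (f y)) (by
    intro g hg x
    congr 1
    simp only [hf]
    refine Finset.sum_congr rfl fun a _ => Finset.sum_congr rfl fun a' _ => ?_
    obtain ⟨k, hk⟩ := hΛ (a - a') g hg
    rw [hadd, hk, mul_add, add_comm, mul_comm (2 * Real.pi) (k : ℝ), Real.cos_add_int_mul_two_pi])
  rw [← ofReal_integral_eq_lintegral_ofReal hfint (Filter.Eventually.of_forall hf0), hint] at h1
  have h2 : ENNReal.ofReal ((S.card : ℝ) ^ 2 / 4) * μ A ≤ ∫⁻ y in A, ENNReal.ofReal (f y) ∂μ := by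
    rw [← setLIntegral_const]
    refine setLIntegral_mono' hA fun y hy => ENNReal.ofReal_le_ofReal ?_
    rw [hf2]
    have h3 : (S.card : ℝ) / 2 ≤ ∑ a ∈ S, Real.cos (2 * Real.pi * φ a y) := by
      have : (S.card : ℝ) / 2 = ∑ a ∈ S, (1 / 2 : ℝ) := by simp; ring
      rw [this]
      refine Finset.sum_le_sum fun a ha => ?_
      have h4 := hsmall a ha y hy
      rw [← Real.cos_abs, ← Real.cos_pi_div_three]
      have hpi := Real.pi_pos
      apply Real.cos_le_cos_of_nonneg_of_le_pi (abs_nonneg _)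
      · linarith
      · rw [abs_mul, abs_of_pos (by positivity)]
        nlinarith
    have h5 : 0 ≤ (S.card : ℝ) / 2 := by positivity
    nlinarith [sq_nonneg (∑ a ∈ S, Real.sin (2 * Real.pi * φ a y))]
  have h3 := h2.trans h1
  have hcard : (0 : ℝ) < S.card := by exact_mod_cast hne.card_pos
  rw [ENNReal.ofReal_mul hcard.le, ENNReal.ofReal_toReal hfin.ne] at h3
  have h4 : ENNReal.ofReal ((S.card : ℝ) ^ 2 / 4) = ENNReal.ofReal (S.card : ℝ) *
      (ENNReal.ofReal (S.card : ℝ) * 4⁻¹) := by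
    rw [div_eq_mul_inv, ENNReal.ofReal_mul (by positivity), sq, ENNReal.ofReal_mul hcard.le,
      ENNReal.ofReal_inv_of_pos (by norm_num), mul_assoc]
    simp
  rw [h4, mul_assoc, ENNReal.mul_le_mul_iff_right (by simpa using hne.ne_empty) (by simp)] at h3
  rw [ENNReal.ofReal_natCast] at h3
  calc _ = 4 * ((S.card : ENNReal) * 4⁻¹ * μ A) := by
        rw [show (4 : ENNReal) * ((S.card : ENNReal) * 4⁻¹ * μ A) =
          (4 * 4⁻¹) * ((S.card : ENNReal) * μ A) by ring,
          ENNReal.mul_inv_cancel (by simp) (by simp), one_mul]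
    _ ≤ _ := by gcongr

end abstractCount


section latticeCount
open mixedEmbedding

open scoped Classical in
/-- The trace form on the mixed space. -/
noncomputable def trForm (K : Type) [Field K] [NumberField K] (y : mixedSpace K) : ℝ :=
  ∑ w : InfinitePlace K, (w.mult : ℝ) * (if hw : w.IsReal then y.1 ⟨w, hw⟩
    else (y.2 ⟨w, InfinitePlace.not_isReal_iff_isComplex.mp hw⟩).re)

lemma trForm_add (K : Type) [Field K] [NumberField K] (x y : mixedSpace K) :
    trForm K (x + y) = trForm K x + trForm K y := by
  unfold trForm
  rw [← Finset.sum_add_distrib]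
  refine Finset.sum_congr rfl fun w _ => ?_
  split_ifs <;> simp [mul_add]

lemma trForm_sub (K : Type) [Field K] [NumberField K] (x y : mixedSpace K) :
    trForm K (x - y) = trForm K x - trForm K y := by
  have := trForm_add K (x - y) y
  rw [sub_add_cancel] at this
  linarith

lemma trForm_continuous (K : Type) [Field K] [NumberField K] : Continuous (trForm K) := by
  unfold trForm
  refine continuous_finsetSum _ fun w _ => ?_
  split_ifs <;> fun_prop

lemma trForm_mixed (K : Type) [Field K] [NumberField K] (x : K) :
    trForm K (mixedEmbedding K x) = (Algebra.trace ℚ K x : ℝ) := by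
  classical
  have h := trace_eq_sum_embeddings (K := ℚ) ℂ (x := x)
  have h2 : ∑ φ : K →ₐ[ℚ] ℂ, φ x = ∑ φ : K →+* ℂ, φ x :=
    (Fintype.sum_equiv (RingHom.equivRatAlgHom K ℂ) (fun f => f x) (fun φ => φ x)
      fun _ => by simp [RingHom.equivRatAlgHom_apply]).symm
  rw [h2] at h
  have h3 := congrArg Complex.re h
  simp only [eq_ratCast, Complex.ratCast_re, Complex.re_sum] at h3
  rw [h3, ← Finset.sum_fiberwise Finset.univ InfinitePlace.mk (fun φ => (φ x).re)]
  unfold trForm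
  refine Finset.sum_congr rfl fun w _ => ?_
  have h4 : ∀ φ ∈ ({φ | InfinitePlace.mk φ = w} : Finset (K →+* ℂ)),
      (φ x).re = (w.embedding x).re := by
    intro φ hφ
    rw [← (Finset.mem_filter.mp hφ).2]
    rcases InfinitePlace.embedding_mk_eq φ with h | h
    · rw [h]
    · rw [h]; simp
  rw [Finset.sum_congr rfl h4, Finset.sum_const, InfinitePlace.card_filter_mk_eq, nsmul_eq_mul]
  congr 1
  split_ifs with hw
  · rw [mixedEmbedding_apply_isReal]
    have := InfinitePlace.embedding_of_isReal_apply hw x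
    rw [← this, Complex.ofReal_re]
  · rw [mixedEmbedding_apply_isComplex]

lemma abs_trForm_le (K : Type) [Field K] [NumberField K] (y : mixedSpace K) (c : ℝ)
    (h : ∀ w, normAtPlace w y ≤ c) : |trForm K y| ≤ Module.finrank ℚ K * c := by
  unfold trForm
  refine (Finset.abs_sum_le_sum_abs _ _).trans ?_
  rw [← InfinitePlace.sum_mult_eq, Nat.cast_sum, Finset.sum_mul]
  refine Finset.sum_le_sum fun w _ => ?_
  rw [abs_mul, abs_of_nonneg (Nat.cast_nonneg _)]
  refine mul_le_mul_of_nonneg_left (le_trans ?_ (h w)) (Nat.cast_nonneg _)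
  split_ifs with hw
  · rw [normAtPlace_apply_of_isReal hw]; rfl
  · rw [normAtPlace_apply_of_isComplex (InfinitePlace.not_isReal_iff_isComplex.mp hw)]
    exact Complex.abs_re_le_norm _

/-- The inverse different. -/
noncomputable def invDiff (K : Type) [Field K] [NumberField K] :
    (FractionalIdeal (nonZeroDivisors (𝓞 K)) K)ˣ :=
  (FractionalIdeal.mk0 K ⟨differentIdeal ℤ (𝓞 K),
    mem_nonZeroDivisors_of_ne_zero differentIdeal_ne_bot⟩)⁻¹

lemma invDiff_coe (K : Type) [Field K] [NumberField K] :
    (invDiff K : FractionalIdeal (nonZeroDivisors (𝓞 K)) K) = FractionalIdeal.dual ℤ ℚ 1 := by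
  unfold invDiff
  rw [Units.val_inv_eq_inv_val, FractionalIdeal.coe_mk0, coeIdeal_differentIdeal ℤ ℚ, inv_inv]

lemma invDiff_absNorm (K : Type) [Field K] [NumberField K] :
    (FractionalIdeal.absNorm (invDiff K).1 : ℝ) = |(discr K : ℝ)|⁻¹ := by
  unfold invDiff
  rw [Units.val_inv_eq_inv_val, FractionalIdeal.coe_mk0, map_inv₀, FractionalIdeal.coeIdeal_absNorm,
    NumberField.absNorm_differentIdeal (K := K)]
  simp [Nat.cast_natAbs]

lemma norm_ge_of_mem (K : Type) [Field K] [NumberField K] (z : K) (hz : z ≠ 0)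
    (h : z ∈ (invDiff K : FractionalIdeal (nonZeroDivisors (𝓞 K)) K)) :
    |(discr K : ℝ)|⁻¹ ≤ |(Algebra.norm ℚ z : ℝ)| := by
  have h1 : FractionalIdeal.spanSingleton (nonZeroDivisors (𝓞 K)) z ≤ (invDiff K).1 := by
    rwa [FractionalIdeal.spanSingleton_le_iff_mem]
  have h2 : (invDiff K).1⁻¹ * FractionalIdeal.spanSingleton (nonZeroDivisors (𝓞 K)) z ≤ 1 := by
    calc _ ≤ (invDiff K).1⁻¹ * (invDiff K).1 := mul_le_mul_right h1 _
      _ = 1 := inv_mul_cancel₀ (invDiff K).ne_zero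
  obtain ⟨J, hJ⟩ := FractionalIdeal.le_one_iff_exists_coeIdeal.mp h2
  have h3 := congrArg FractionalIdeal.absNorm hJ
  rw [map_mul, map_inv₀, FractionalIdeal.absNorm_span_singleton, FractionalIdeal.coeIdeal_absNorm] at h3
  have hJ0 : J ≠ 0 := by
    rintro rfl
    have h4 := hJ.symm
    rw [Ideal.zero_eq_bot, FractionalIdeal.coeIdeal_bot, mul_eq_zero] at h4
    rcases h4 with h4 | h4
    · exact inv_ne_zero (invDiff K).ne_zero h4
    · exact hz (FractionalIdeal.spanSingleton_eq_zero_iff.mp h4)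
  have h5 : (1 : ℝ) ≤ (Ideal.absNorm J : ℝ) := by
    have : Ideal.absNorm J ≠ 0 := by rwa [Ne, Ideal.absNorm_eq_zero_iff]
    exact_mod_cast Nat.one_le_iff_ne_zero.mpr this
  have h6 := congrArg (fun q : ℚ => (q : ℝ)) h3
  simp only [Rat.cast_natCast, Rat.cast_mul, Rat.cast_inv, Rat.cast_abs, invDiff_absNorm, inv_inv] at h6
  have hD := one_le_abs_discr K
  rw [inv_le_iff_one_le_mul₀' (by linarith), ← h6]
  exact h5

open scoped Classical in
lemma lattice_count (K : Type) [Field K] [NumberField K] (R : ℝ) (hR : 0 < R)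
    (hRD : |(discr K : ℝ)| ≤ R ^ (Module.finrank ℚ K)) (S : Finset (𝓞 K))
    (hS : ∀ α ∈ S, ∀ w : InfinitePlace K, w (α : K) ≤ R) :
    (S.card : ℝ) * Real.sqrt |(discr K : ℝ)| ≤
      4 * (6 * Module.finrank ℚ K) ^ (Module.finrank ℚ K) * R ^ (Module.finrank ℚ K) := by
  set n := Module.finrank ℚ K with hn
  have hnpos : 0 < n := Module.finrank_pos
  have hn1 : (1 : ℝ) ≤ n := by exact_mod_cast hnpos
  have hD := one_le_abs_discr K
  set D := |(discr K : ℝ)| with hDdef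
  let c : NNReal := ⟨1 / (6 * n * R), by positivity⟩
  have hcR : (c : ℝ) = 1 / (6 * n * R) := rfl
  let A := convexBodyLT K (fun _ => c)
  have hAmem : ∀ y ∈ A, ∀ w, normAtPlace w y < c := by
    intro y hy w
    by_cases hw : w.IsReal
    · rw [normAtPlace_apply_of_isReal hw]
      have := hy.1 ⟨w, hw⟩ (Set.mem_univ _)
      simpa using this
    · rw [InfinitePlace.not_isReal_iff_isComplex] at hw
      rw [normAtPlace_apply_of_isComplex hw]
      have := hy.2 ⟨w, hw⟩ (Set.mem_univ _)
      simpa using this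
  have key := count_abstract MeasureTheory.volume (fractionalIdealLatticeBasis K (invDiff K)) S
    (fun α y => trForm K (mixedEmbedding K (α : K) * y))
    (fun a => (trForm_continuous K).comp (continuous_const.mul continuous_id))
    (fun a x y => by rw [mul_add, trForm_add])
    (fun a a' x => by
      rw [← trForm_sub, ← sub_mul, ← map_sub]; simp)
    (fun a x hx => by
      rw [mem_span_fractionalIdealLatticeBasis] at hx
      obtain ⟨z, hz, rfl⟩ := hx
      rw [← map_mul, trForm_mixed]
      rw [SetLike.mem_coe, invDiff_coe, FractionalIdeal.mem_dual (one_ne_zero (α := FractionalIdeal (nonZeroDivisors (𝓞 K)) K))] at hz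
      obtain ⟨k, hk⟩ := hz (a : K) ((FractionalIdeal.mem_one_iff _).mpr ⟨a, rfl⟩)
      refine ⟨k, ?_⟩
      rw [Algebra.traceForm_apply, mul_comm] at hk
      rw [← hk]; simp)
    (fun a ha => by
      have ha' : (a : K) ≠ 0 := by simpa using ha
      refine ⟨mixedEmbedding K ((a : K)⁻¹ * algebraMap ℚ K (1 / (2 * n))), ?_⟩
      rw [← map_mul, ← mul_assoc, mul_inv_cancel₀ ha', one_mul, trForm_mixed, Algebra.trace_algebraMap]
      simp [← hn]
      field_simp)
    A
    (MeasurableSet.prod (MeasurableSet.univ_pi fun _ => measurableSet_ball)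
      (MeasurableSet.univ_pi fun _ => measurableSet_ball))
    (fun x hx y hy hxy => by
      rw [mem_span_fractionalIdealLatticeBasis] at hxy
      obtain ⟨z, hz, hz'⟩ := hxy
      by_contra hne
      have hz0 : z ≠ 0 := by
        rintro rfl
        rw [map_zero] at hz'
        exact hne (sub_eq_zero.mp hz'.symm)
      have h1 := norm_ge_of_mem K z hz0 hz
      have h2 : ∀ w : InfinitePlace K, w z ≤ 2 * c := by
        intro w
        rw [← normAtPlace_apply, hz', sub_eq_add_neg]
        have h3 := normAtPlace_add_le w x (-y)
        rw [normAtPlace_neg] at h3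
        linarith [hAmem x hx w, hAmem y hy w]
      have h3 : |(Algebra.norm ℚ z : ℝ)| ≤ (2 * c) ^ n := by
        rw [← Rat.cast_abs, ← InfinitePlace.prod_eq_abs_norm, ← prod_place_eq]
        refine Finset.prod_le_prod (fun w _ => pow_nonneg (apply_nonneg _ _) _) fun w _ => ?_
        exact pow_le_pow_left₀ (apply_nonneg _ _) (h2 w) _
      have h4 : (2 * (c : ℝ)) ^ n < R⁻¹ ^ n := by
        refine pow_lt_pow_left₀ ?_ (by positivity) hnpos.ne'
        rw [hcR, show 2 * (1 / (6 * n * R)) = (1 / (3 * n)) * R⁻¹ by field_simp; norm_num]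
        refine mul_lt_of_lt_one_left (by positivity) ?_
        rw [div_lt_one (by positivity)]
        linarith
      have h5 : R⁻¹ ^ n ≤ D⁻¹ := by
        rw [inv_pow]
        exact inv_anti₀ (by linarith) hRD
      linarith)
    (fun a ha y hy => by
      have := abs_trForm_le K (mixedEmbedding K (a : K) * y) (R * c) (fun w => by
        rw [map_mul, normAtPlace_apply]
        exact mul_le_mul (hS a ha w) (hAmem y hy w).le (normAtPlace_nonneg _ _) hR.le)
      refine this.trans (le_of_eq ?_)
      rw [hcR, ← hn]
      field_simp)
  have hvolA : ENNReal.ofReal ((1 / (6 * n * R)) ^ n) ≤ MeasureTheory.volume A := by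
    rw [convexBodyLT_volume, ← ENNReal.coe_mul]
    rw [← ENNReal.ofReal_coe_nnreal]
    apply ENNReal.ofReal_le_ofReal
    push_cast
    rw [prod_place_eq, hcR, ← hn]
    have h1 : (1 : ℝ) ≤ (convexBodyLTFactor K : ℝ) := by exact_mod_cast one_le_convexBodyLTFactor K
    have h2 : (0 : ℝ) ≤ (1 / (6 * n * R)) ^ n := by positivity
    have h3 := mul_le_mul_of_nonneg_right h1 h2
    rw [one_mul] at h3
    refine h3.trans (le_of_eq ?_)
    push_cast
    rfl
  have hfund := vol_fund_le K (invDiff K)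
  rw [invDiff_absNorm] at hfund
  have h6 : ENNReal.ofReal ((S.card : ℝ) * (1 / (6 * n * R)) ^ n) ≤
      ENNReal.ofReal (4 * (D⁻¹ * Real.sqrt D)) := by
    rw [ENNReal.ofReal_mul (by positivity), ENNReal.ofReal_mul (by norm_num)]
    calc _ ≤ (S.card : ENNReal) * MeasureTheory.volume A := by
          rw [ENNReal.ofReal_natCast]; gcongr
      _ ≤ _ := key
      _ ≤ _ := by
          have : ENNReal.ofReal 4 = 4 := by simp
          rw [this]; gcongr
  rw [ENNReal.ofReal_le_ofReal_iff (by positivity)] at h6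
  have hsq : Real.sqrt D * Real.sqrt D = D := Real.mul_self_sqrt (by linarith)
  have h7 : (S.card : ℝ) * Real.sqrt D = ((S.card : ℝ) * (1 / (6 * n * R)) ^ n) * Real.sqrt D *
      ((6 * n) ^ n * R ^ n) := by
    rw [← mul_pow, one_div, inv_pow]
    field_simp
  rw [h7]
  have hX : 0 ≤ (6 * (n : ℝ)) ^ n * R ^ n := by positivity
  calc _ ≤ 4 * (D⁻¹ * Real.sqrt D) * Real.sqrt D * ((6 * n) ^ n * R ^ n) := by gcongr
    _ = 4 * (D⁻¹ * (Real.sqrt D * Real.sqrt D)) * ((6 * n) ^ n * R ^ n) := by ring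
    _ = _ := by rw [hsq, inv_mul_cancel₀ (by linarith)]; ring

end latticeCount

section part_D1
open Polynomial

section detMethod

lemma vandermonde_dvd {R : Type*} [CommRing R] (s : ℕ) (t : Fin s → R) (ψ : Fin s → R[X]) :
    (Matrix.vandermonde t).det ∣ (Matrix.of fun i j => (ψ j).eval (t i)).det := by
  nontriviality R
  let P : R[X] := ∏ i, (X - C (t i))
  have hP : P.Monic := monic_prod_of_monic _ _ fun i _ => monic_X_sub_C _
  have hdeg : P.natDegree = s := by
    simp only [P]
    rw [natDegree_prod_of_monic _ _ fun i _ => monic_X_sub_C _]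
    simp
  have hmat : (Matrix.of fun i j => (ψ j).eval (t i)) =
      Matrix.vandermonde t * (Matrix.of fun (k j : Fin s) => (ψ j %ₘ P).coeff k) := by
    ext i j
    rw [Matrix.mul_apply]
    simp only [Matrix.of_apply, Matrix.vandermonde_apply]
    have h1 : (ψ j).eval (t i) = (ψ j %ₘ P).eval (t i) := by
      conv_lhs => rw [← modByMonic_add_div (ψ j) P]
      have : P.eval (t i) = 0 := by
        simp only [P, eval_prod]
        exact Finset.prod_eq_zero (Finset.mem_univ i) (by simp)
      rw [eval_add, eval_mul, this, zero_mul, add_zero]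
    have h2 : (ψ j %ₘ P).degree < s := by
      have := degree_modByMonic_lt (ψ j) hP
      rwa [degree_eq_natDegree hP.ne_zero, hdeg] at this
    rw [h1]
    by_cases h0 : ψ j %ₘ P = 0
    · simp [h0]
    rw [eval_eq_sum_range' (n := s) ((natDegree_lt_iff_degree_lt h0).mpr h2), Finset.sum_range]
    exact Finset.sum_congr rfl fun k _ => mul_comm _ _
  rw [hmat, Matrix.det_mul]
  exact dvd_mul_right _ _

lemma sum_Ioi (s : ℕ) : ∑ i : Fin s, (Finset.Ioi i).card = s * (s - 1) / 2 := by
  simp only [Fin.card_Ioi]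
  rw [← Finset.sum_range_id_mul_two, Nat.mul_div_cancel _ (by norm_num)]
  rw [Finset.sum_range (n := s) (f := fun i => i)]
  refine Fintype.sum_equiv Fin.revPerm _ _ fun i => ?_
  simp [Fin.val_rev]
  omega

lemma pow_dvd_vandermonde {R : Type*} [CommRing R] (p : R) (s : ℕ) (t : Fin s → R) (t₀ : R)
    (h : ∀ i, p ∣ t i - t₀) : p ^ (s * (s - 1) / 2) ∣ (Matrix.vandermonde t).det := by
  rw [Matrix.det_vandermonde, ← sum_Ioi, ← Finset.prod_pow_eq_pow_sum]
  refine Finset.prod_dvd_prod_of_dvd _ _ fun i _ => ?_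
  rw [← Finset.prod_const]
  refine Finset.prod_dvd_prod_of_dvd _ _ fun j _ => ?_
  have := dvd_sub (h j) (h i)
  rwa [sub_sub_sub_cancel_right] at this

lemma newton_lift {R : Type*} [CommRing R] (p : R) (G : R[X]) (t₀ y₀ v : R)
    (hv : p ∣ 2 * y₀ * v - 1) (L : ℕ) :
    ∃ W : R[X], ∀ t y, p ∣ t - t₀ → p ∣ y - y₀ → y ^ 2 = G.eval t → p ^ (L + 1) ∣ W.eval t - y := by
  induction L with
  | zero =>
    refine ⟨C y₀, fun t y _ hy _ => ?_⟩
    rw [eval_C, zero_add, pow_one, ← neg_sub]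
    exact (dvd_neg).mpr hy
  | succ L ih =>
    obtain ⟨W, hW⟩ := ih
    refine ⟨W - C v * (W ^ 2 - G), fun t y ht hy h => ?_⟩
    have h1 := hW t y ht hy h
    have h2 : (W - C v * (W ^ 2 - G)).eval t - y = (W.eval t - y) * (1 - v * (W.eval t + y)) := by
      simp only [eval_sub, eval_mul, eval_C, eval_pow]
      rw [← h]; ring
    rw [h2, pow_succ]
    refine mul_dvd_mul h1 ?_
    have h3 : p ∣ W.eval t - y := (dvd_pow_self p (Nat.succ_ne_zero L)).trans h1
    have h4 : 1 - v * (W.eval t + y) = -(2 * y₀ * v - 1) - v * ((W.eval t - y) + 2 * (y - y₀)) := by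
      ring
    rw [h4]
    exact dvd_sub ((dvd_neg).mpr hv) (Dvd.dvd.mul_left (dvd_add h3 (Dvd.dvd.mul_left hy _)) _)

lemma det_sub_dvd {R : Type*} [CommRing R] (q : R) {n : Type*} [Fintype n] [DecidableEq n]
    (M N : Matrix n n R) (h : ∀ i j, q ∣ M i j - N i j) : q ∣ M.det - N.det := by
  rw [← Ideal.mem_span_singleton, ← Ideal.Quotient.eq, RingHom.map_det, RingHom.map_det]
  congr 1
  ext i j
  simp only [RingHom.mapMatrix_apply, Matrix.map_apply]
  rw [Ideal.Quotient.eq, Ideal.mem_span_singleton]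
  exact h i j

/-- the monomial matrix row -/
def monRow {R : Type*} [CommRing R] (r : ℕ) (t y : R) : Fin (r + r) → R :=
  Fin.append (fun i : Fin r => t ^ (i : ℕ)) (fun i : Fin r => t ^ (i : ℕ) * y)

lemma pow_dvd_det {R : Type*} [CommRing R] (p : R) (G : R[X]) (t₀ y₀ v : R)
    (hv : p ∣ 2 * y₀ * v - 1) (r : ℕ) (t y : Fin (r + r) → R)
    (ht : ∀ i, p ∣ t i - t₀) (hy : ∀ i, p ∣ y i - y₀) (hG : ∀ i, (y i) ^ 2 = G.eval (t i)) :
    p ^ (r * (2 * r - 1)) ∣ (Matrix.of fun i => monRow r (t i) (y i)).det := by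
  obtain ⟨W, hW⟩ := newton_lift p G t₀ y₀ v hv (r * (2 * r - 1))
  let ψ : Fin (r + r) → R[X] :=
    Fin.append (fun i : Fin r => X ^ (i : ℕ)) (fun i : Fin r => X ^ (i : ℕ) * W)
  have h1 : p ^ (r * (2 * r - 1)) ∣ (Matrix.of fun i j => (ψ j).eval (t i)).det := by
    have h2 := (pow_dvd_vandermonde p _ t t₀ ht).trans (vandermonde_dvd _ t ψ)
    have h3 : (r + r) * (r + r - 1) / 2 = r * (2 * r - 1) := by
      rw [← two_mul, mul_assoc, Nat.mul_div_cancel_left _ (by norm_num)]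
    rwa [h3] at h2
  have h4 := det_sub_dvd (p ^ (r * (2 * r - 1))) (Matrix.of fun i => monRow r (t i) (y i))
    (Matrix.of fun i j => (ψ j).eval (t i)) (by
      intro i j
      simp only [Matrix.of_apply]
      refine Fin.addCases (fun k => ?_) (fun k => ?_) j
      · simp [monRow, ψ]
      · simp only [monRow, ψ, Fin.append_right, eval_mul, eval_pow, eval_X]
        rw [← mul_sub, ← neg_sub, mul_neg, dvd_neg]
        exact Dvd.dvd.mul_left ((pow_dvd_pow p (Nat.le_succ _)).trans
          (hW _ _ (ht i) (hy i) (hG i))) _)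
  have := dvd_add h4 h1
  rwa [sub_add_cancel] at this

lemma abv_det_le {R : Type*} [CommRing R] [Nontrivial R] (abv : AbsoluteValue R ℝ) {n : Type*} [Fintype n] [DecidableEq n]
    (M : Matrix n n R) (c : n → ℝ) (h : ∀ i j, abv (M i j) ≤ c j) :
    abv M.det ≤ (Fintype.card n).factorial * ∏ j, c j := by
  rw [Matrix.det_apply]
  refine (abv.sum_le _ _).trans ?_
  rw [← Fintype.card_perm, ← nsmul_eq_mul, ← Finset.card_univ, ← Finset.sum_const]
  refine Finset.sum_le_sum fun σ _ => ?_
  rw [abv.map_units_int_smul, map_prod]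
  exact Finset.prod_le_prod (fun _ _ => abv.nonneg _) fun j _ => h _ _

lemma exists_place_ge_one (F : Type) [Field F] [NumberField F] (δ : 𝓞 F) (h : δ ≠ 0) :
    ∃ w : InfinitePlace F, 1 ≤ w (δ : F) := by
  by_contra! hlt
  have h1 := InfinitePlace.prod_eq_abs_norm (δ : F)
  have h2 : ∏ w : InfinitePlace F, w (δ : F) ^ w.mult < 1 := by
    rw [← Finset.prod_const_one (s := (Finset.univ : Finset (InfinitePlace F)))]
    refine Finset.prod_lt_prod_of_nonempty (fun w _ => ?_) (fun w _ => ?_) Finset.univ_nonempty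
    · exact pow_pos (InfinitePlace.pos_iff.mpr (by simpa using h)) _
    · exact pow_lt_one₀ (apply_nonneg _ _) (hlt w) InfinitePlace.mult_ne_zero
  rw [h1, ← Algebra.coe_norm_int] at h2
  have h3 : (1 : ℤ) ≤ |Algebra.norm ℤ δ| := Int.one_le_abs (Algebra.norm_ne_zero_iff.mpr h)
  have h4 : (1 : ℝ) ≤ |((Algebra.norm ℤ δ : ℚ) : ℝ)| := by exact_mod_cast h3
  push_cast at h2 h4
  linarith

lemma det_zero (F : Type) [Field F] [NumberField F] (p : ℕ) (G : (𝓞 F)[X]) (t₀ y₀ v : 𝓞 F)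
    (hv : (p : 𝓞 F) ∣ 2 * y₀ * v - 1) (r : ℕ) (t y : Fin (r + r) → 𝓞 F)
    (ht : ∀ i, (p : 𝓞 F) ∣ t i - t₀) (hy : ∀ i, (p : 𝓞 F) ∣ y i - y₀)
    (hG : ∀ i, (y i) ^ 2 = G.eval (t i)) (B H : ℝ)
    (htB : ∀ i, ∀ w : InfinitePlace F, w (t i : F) ≤ 2 * B)
    (hyH : ∀ i, ∀ w : InfinitePlace F, w (y i : F) ≤ H)
    (hp : ((r + r).factorial : ℝ) * ((2 * B) ^ (r * (r - 1)) * H ^ r) < (p : ℝ) ^ (r * (2 * r - 1))) :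
    (Matrix.of fun i => monRow r (t i) (y i)).det = 0 := by
  by_contra hne
  obtain ⟨δ, hδ⟩ := pow_dvd_det (p : 𝓞 F) G t₀ y₀ v hv r t y ht hy hG
  have hδ0 : δ ≠ 0 := by
    rintro rfl
    exact hne (by rw [hδ, mul_zero])
  obtain ⟨w, hw⟩ := exists_place_ge_one F δ hδ0
  let abv : AbsoluteValue (𝓞 F) ℝ := w.1.comp (f := algebraMap (𝓞 F) F) RingOfIntegers.coe_injective
  have habv : ∀ x, abv x = w (x : F) := fun x => rfl
  have h1 : (p : ℝ) ^ (r * (2 * r - 1)) ≤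
      abv (Matrix.of fun i => monRow r (t i) (y i)).det := by
    rw [hδ, map_mul, map_pow, habv δ, habv (p : 𝓞 F)]
    have : w (((p : 𝓞 F)) : F) = p := by simp
    rw [this]
    exact le_mul_of_one_le_right (by positivity) hw
  have h2 := abv_det_le abv (Matrix.of fun i => monRow r (t i) (y i))
    (Fin.append (fun i : Fin r => (2 * B) ^ (i : ℕ)) (fun i : Fin r => (2 * B) ^ (i : ℕ) * H)) (by
      intro i j
      simp only [Matrix.of_apply]
      refine Fin.addCases (fun k => ?_) (fun k => ?_) j
      · simp only [monRow, Fin.append_left]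
        rw [map_pow]
        exact pow_le_pow_left₀ (abv.nonneg _) (htB i w) _
      · simp only [monRow, Fin.append_right]
        rw [map_mul, map_pow]
        refine mul_le_mul (pow_le_pow_left₀ (abv.nonneg _) (htB i w) _) (hyH i w) (abv.nonneg _) ?_
        exact pow_nonneg ((apply_nonneg _ _).trans (htB i w)) _)
  rw [Fin.prod_univ_add] at h2
  simp only [Fin.append_left, Fin.append_right, Finset.prod_mul_distrib, Finset.prod_const,
    Finset.card_univ, Fintype.card_fin, Finset.prod_pow_eq_pow_sum] at h2
  have h3 : (∑ i : Fin r, (i : ℕ)) + (∑ i : Fin r, (i : ℕ)) = r * (r - 1) := by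
    rw [← mul_two, ← Finset.sum_range_id_mul_two, Finset.sum_range (n := r) (f := fun i => i)]
  rw [← h3, pow_add] at hp
  linarith

end detMethod

end part_D1

section part_D2
open Polynomial

section detMethod2

lemma parity_aux {F : Type*} [Field F] (e : F) (he : e ≠ 0) (g A C' : F[X]) (hg : Irreducible g)
    (h : A ^ 2 = C e * g * C' ^ 2) : A = 0 ∧ C' = 0 := by
  have hgp : Prime g := hg.prime
  by_cases hC : C' = 0
  · subst hC
    refine ⟨?_, rfl⟩
    simpa using h
  exfalso
  have hA : A ≠ 0 := by
    rintro rfl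
    have h1 : C e * g * C' ^ 2 ≠ 0 :=
      mul_ne_zero (mul_ne_zero (by simpa using he) hg.ne_zero) (pow_ne_zero _ hC)
    exact h1 (by rw [← h]; simp)
  have hfA : FiniteMultiplicity g A := FiniteMultiplicity.of_prime_left hgp hA
  have hfC : FiniteMultiplicity g C' := FiniteMultiplicity.of_prime_left hgp hC
  have h1 := congrArg (emultiplicity g) h
  have hu : emultiplicity g (C e) = 0 := by
    rw [emultiplicity_eq_zero]
    intro hdvd
    exact hg.not_isUnit (isUnit_of_dvd_unit hdvd (by simpa using he))
  rw [emultiplicity_pow hgp, emultiplicity_mul hgp, emultiplicity_mul hgp, emultiplicity_pow hgp, hu,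
    (FiniteMultiplicity.of_prime_left hgp hg.ne_zero).emultiplicity_self,
    hfA.emultiplicity_eq_multiplicity, hfC.emultiplicity_eq_multiplicity] at h1
  have h2 : 2 * multiplicity g A = 0 + 1 + 2 * multiplicity g C' := by exact_mod_cast h1
  omega

lemma class_bound (F : Type) [Field F] [NumberField F] (p : ℕ) (e : 𝓞 F) (he : e ≠ 0)
    (g : (𝓞 F)[X]) (m : ℕ) (hm : g.natDegree = m)
    (hgirr : Irreducible (g.map (algebraMap (𝓞 F) F))) (t₀ y₀ v : 𝓞 F)
    (hv : (p : 𝓞 F) ∣ 2 * y₀ * v - 1) (r : ℕ) (T : Finset (𝓞 F)) (y : 𝓞 F → 𝓞 F)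
    (ht : ∀ t ∈ T, (p : 𝓞 F) ∣ t - t₀) (hy : ∀ t ∈ T, (p : 𝓞 F) ∣ y t - y₀)
    (hG : ∀ t ∈ T, (y t) ^ 2 = e * g.eval t) (B H : ℝ)
    (htB : ∀ t ∈ T, ∀ w : InfinitePlace F, w (t : F) ≤ 2 * B)
    (hyH : ∀ t ∈ T, ∀ w : InfinitePlace F, w (y t : F) ≤ H)
    (hp : ((r + r).factorial : ℝ) * ((2 * B) ^ (r * (r - 1)) * H ^ r) < (p : ℝ) ^ (r * (2 * r - 1))) :
    T.card ≤ 2 * r + m := by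
  classical
  let V : 𝓞 F → (Fin (r + r) → F) := fun t => monRow r (t : F) (y t : F)
  have hspan : Submodule.span F (V '' T) < ⊤ := by
    rw [lt_top_iff_ne_top]
    intro htop
    obtain ⟨f, hf, -, hlin⟩ := Submodule.exists_fun_fin_finrank_span_eq F (V '' (T : Set (𝓞 F)))
    have hcard : Module.finrank F (Submodule.span F (V '' (T : Set (𝓞 F)))) = r + r := by
      rw [htop]; simp
    obtain ⟨f', hf', hlin'⟩ : ∃ f' : Fin (r + r) → (Fin (r + r) → F),
        (∀ i, f' i ∈ V '' (T : Set (𝓞 F))) ∧ LinearIndependent F f' := by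
      exact ⟨f ∘ Fin.cast hcard.symm, fun i => hf _,
        hlin.comp _ (Fin.cast_injective _)⟩
    choose t htT hft using hf'
    have hdet := det_zero F p (C e * g) t₀ y₀ v hv r t (fun i => y (t i)) (fun i => ht _ (htT i))
      (fun i => hy _ (htT i)) (fun i => by rw [hG _ (htT i)]; simp) B H (fun i => htB _ (htT i))
      (fun i => hyH _ (htT i)) hp
    have hM : (Matrix.of f') = (algebraMap (𝓞 F) F).mapMatrix
        (Matrix.of fun i => monRow r (t i) (y (t i))) := by
      ext i j
      simp only [Matrix.of_apply, RingHom.mapMatrix_apply, Matrix.map_apply]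
      rw [← hft i]
      refine Fin.addCases (fun k => ?_) (fun k => ?_) j
      · simp [V, monRow]
      · simp only [V, monRow, Fin.append_right, map_mul, map_pow]
    have h1 : (Matrix.of f').det = 0 := by
      rw [hM, ← RingHom.map_det, hdet, map_zero]
    have h2 : IsUnit (Matrix.of f') := by
      rw [← Matrix.linearIndependent_rows_iff_isUnit]
      exact hlin'
    rw [Matrix.isUnit_iff_isUnit_det, h1] at h2
    exact not_isUnit_zero h2
  obtain ⟨f, hf0, hf⟩ := Submodule.exists_le_ker_of_lt_top _ hspan
  let c : Fin (r + r) → F := fun j => f (Pi.single j 1)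
  have hfc : ∀ x, f x = ∑ j, x j * c j := by
    intro x
    rw [LinearMap.pi_apply_eq_sum_univ f x]
    refine Finset.sum_congr rfl fun j _ => ?_
    rw [smul_eq_mul]
    congr 2
    ext k
    simp [Pi.single_apply, eq_comm]
  let P : F[X] := ∑ i : Fin r, C (c (Fin.castAdd r i)) * X ^ (i : ℕ)
  let Q : F[X] := ∑ i : Fin r, C (c (Fin.natAdd r i)) * X ^ (i : ℕ)
  have hPQ : ∀ t ∈ T, P.eval (t : F) + Q.eval (t : F) * (y t : F) = 0 := by
    intro t htT
    have h1 : f (V t) = 0 := hf (Submodule.subset_span ⟨t, htT, rfl⟩)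
    rw [hfc, Fin.sum_univ_add] at h1
    rw [← h1]
    simp only [P, Q, eval_finsetSum, Finset.sum_mul, V, monRow, Fin.append_left, Fin.append_right,
      eval_mul, eval_C, eval_pow, eval_X]
    congr 1
    · exact Finset.sum_congr rfl fun _ _ => mul_comm _ _
    · exact Finset.sum_congr rfl fun _ _ => by ring
  have hcoef : ∀ (a : Fin r → F) (k : Fin r), (∑ i : Fin r, C (a i) * X ^ (i : ℕ)).coeff k = a k := by
    intro a k
    rw [finsetSum_coeff, Finset.sum_eq_single k]
    · simp
    · intro i _ hik
      rw [coeff_C_mul, coeff_X_pow, if_neg, mul_zero]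
      exact fun h => hik (Fin.ext h.symm)
    · simp
  have hdeg : ∀ (a : Fin r → F), (∑ i : Fin r, C (a i) * X ^ (i : ℕ)).natDegree ≤ r := by
    intro a
    refine natDegree_sum_le_of_forall_le _ _ fun i _ => ?_
    exact (natDegree_C_mul_X_pow_le _ _).trans i.2.le
  set g' := g.map (algebraMap (𝓞 F) F) with hg'
  let Z : F[X] := P ^ 2 - C (e : F) * g' * Q ^ 2
  have hZ0 : Z ≠ 0 := by
    intro h
    obtain ⟨hP0, hQ0⟩ := parity_aux (e : F) (by simpa using he) g' P Q hgirr (sub_eq_zero.mp h)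
    apply hf0
    refine LinearMap.ext fun x => ?_
    rw [hfc, LinearMap.zero_apply]
    refine Finset.sum_eq_zero fun j _ => ?_
    refine mul_eq_zero_of_right _ ?_
    refine Fin.addCases (fun k => ?_) (fun k => ?_) j
    · have := hcoef (fun i => c (Fin.castAdd r i)) k
      rw [← this]
      change P.coeff k = 0
      rw [hP0, coeff_zero]
    · have := hcoef (fun i => c (Fin.natAdd r i)) k
      rw [← this]
      change Q.coeff k = 0
      rw [hQ0, coeff_zero]
  have hZdeg : Z.natDegree ≤ 2 * r + m := by
    have hP : P.natDegree ≤ r := hdeg _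
    have hQ : Q.natDegree ≤ r := hdeg _
    refine (natDegree_sub_le _ _).trans (max_le ?_ ?_)
    · exact (natDegree_pow_le).trans (by omega)
    · refine natDegree_mul_le.trans ?_
      have h1 : (C (e : F) * g').natDegree ≤ m :=
        (natDegree_C_mul_le _ _).trans (natDegree_map_le.trans hm.le)
      have h2 : (Q ^ 2).natDegree ≤ 2 * Q.natDegree := natDegree_pow_le
      omega
  have hroots : T.image (fun t : 𝓞 F => (t : F)) ⊆ Z.roots.toFinset := by
    intro x hx
    obtain ⟨t, htT, rfl⟩ := Finset.mem_image.mp hx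
    rw [Multiset.mem_toFinset, mem_roots hZ0, IsRoot.def]
    have h1 := hPQ t htT
    have h2 : (y t : F) ^ 2 = (e : F) * g'.eval (t : F) := by
      rw [hg', eval_map, eval₂_at_apply, ← map_pow, hG t htT, map_mul]
    simp only [Z, eval_sub, eval_pow, eval_mul, eval_C]
    rw [← h2]
    linear_combination (P.eval (t : F) - Q.eval (t : F) * (y t : F)) * h1
  calc T.card = (T.image (fun t : 𝓞 F => (t : F))).card :=
        (Finset.card_image_of_injective _ RingOfIntegers.coe_injective).symm
    _ ≤ Z.roots.toFinset.card := Finset.card_le_card hroots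
    _ ≤ Z.roots.card := Multiset.toFinset_card_le _
    _ ≤ Z.natDegree := card_roots' _
    _ ≤ _ := hZdeg

end detMethod2

end part_D2

section part_D3
open Polynomial

section detMethod3

lemma absNorm_natCast_span (K : Type) [Field K] [NumberField K] (p : ℕ) :
    Ideal.absNorm (Ideal.span {(p : 𝓞 K)}) = p ^ Module.finrank ℚ K := by
  have h := Algebra.norm_algebraMap_of_basis (RingOfIntegers.basis K) (p : ℤ)
  rw [Ideal.absNorm_span_singleton]
  have h2 : (p : 𝓞 K) = algebraMap ℤ (𝓞 K) (p : ℤ) := by simp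
  rw [h2, h, ← Module.finrank_eq_card_basis (RingOfIntegers.basis K), RingOfIntegers.rank,
    Int.natAbs_pow]
  simp

lemma primes_over_card (K : Type) [Field K] [NumberField K] (p : ℕ) (hp : p.Prime)
    (PP : Finset (Ideal (𝓞 K))) (h : ∀ P ∈ PP, P.IsPrime ∧ (p : 𝓞 K) ∈ P) :
    PP.card ≤ Module.finrank ℚ K := by
  have hp0 : (p : 𝓞 K) ≠ 0 := by exact_mod_cast hp.ne_zero
  have hP0 : ∀ P ∈ PP, P ≠ ⊥ := by
    rintro P hP rfl
    exact hp0 (by simpa using (h _ hP).2)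
  have h1 : ∏ P ∈ PP, P ∣ Ideal.span {(p : 𝓞 K)} := by
    refine Finset.prod_primes_dvd _ (fun P hP => ?_) (fun P hP => ?_)
    · exact (Ideal.prime_iff_isPrime (hP0 P hP)).mpr (h P hP).1
    · exact Ideal.dvd_span_singleton.mpr (h P hP).2
  have h2 := map_dvd Ideal.absNorm h1
  rw [absNorm_natCast_span, map_prod] at h2
  have h3 : p ^ PP.card ∣ ∏ P ∈ PP, Ideal.absNorm P := by
    rw [← Finset.prod_const]
    refine Finset.prod_dvd_prod_of_dvd _ _ fun P hP => ?_
    have h4 : Ideal.absNorm P ∣ p ^ Module.finrank ℚ K := by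
      rw [← absNorm_natCast_span]
      exact map_dvd Ideal.absNorm (Ideal.dvd_span_singleton.mpr (h P hP).2)
    obtain ⟨k, -, hk⟩ := (Nat.dvd_prime_pow hp).mp h4
    rw [hk]
    refine dvd_pow_self p ?_
    rintro rfl
    rw [pow_zero, Ideal.absNorm_eq_one_iff] at hk
    exact (h P hP).1.ne_top hk
  exact (Nat.pow_dvd_pow_iff_le_right hp.one_lt).mp (h3.trans h2)

lemma sqrt_count (F : Type) [Field F] [NumberField F] (p : ℕ) (hp : p.Prime)
    (Y : Finset (𝓞 F)) (hv : ∀ b ∈ Y, ∃ v, (p : 𝓞 F) ∣ 2 * b * v - 1)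
    (hsq : ∀ b ∈ Y, ∀ b' ∈ Y, (p : 𝓞 F) ∣ b ^ 2 - b' ^ 2)
    (hinj : ∀ b ∈ Y, ∀ b' ∈ Y, (p : 𝓞 F) ∣ b - b' → b = b') :
    Y.card ≤ 2 ^ Module.finrank ℚ F := by
  classical
  rcases Y.eq_empty_or_nonempty with rfl | ⟨b₀, hb₀⟩
  · simp
  obtain ⟨v, hv0⟩ := hv b₀ hb₀
  have hp0 : (Ideal.span {(p : 𝓞 F)}) ≠ 0 := by
    rw [Ne, Ideal.zero_eq_bot, Ideal.span_singleton_eq_bot]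
    exact_mod_cast hp.ne_zero
  let PP : Finset (Ideal (𝓞 F)) :=
    (UniqueFactorizationMonoid.normalizedFactors (Ideal.span {(p : 𝓞 F)})).toFinset
  have hPP : ∀ P, P ∈ PP ↔ P.IsPrime ∧ (p : 𝓞 F) ∈ P := by
    intro P
    simp only [PP, Multiset.mem_toFinset]
    rw [Ideal.mem_normalizedFactors_iff hp0, Ideal.span_singleton_le_iff_mem]
  have hcard := primes_over_card F p hp PP (fun P hP => (hPP P).mp hP)
  have key : Y.card ≤ (PP.powerset).card := by
    refine Finset.card_le_card_of_injOn (fun b => PP.filter (fun P => b - b₀ ∈ P)) ?_ ?_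
    · intro b _
      exact Finset.mem_coe.mpr (Finset.mem_powerset.mpr (Finset.filter_subset _ _))
    · intro b hb b' hb' heq
      refine hinj b hb b' hb' ?_
      have htop : Ideal.span {(p : 𝓞 F), b + b'} = ⊤ := by
        by_contra hne
        obtain ⟨M, hM, hle⟩ := Ideal.exists_le_maximal _ hne
        have hpM : (p : 𝓞 F) ∈ M := hle (Ideal.subset_span (by simp))
        have hbM : b + b' ∈ M := hle (Ideal.subset_span (by simp))
        have hMPP : M ∈ PP := (hPP M).mpr ⟨hM.isPrime, hpM⟩
        have hmem : ∀ x, (p : 𝓞 F) ∣ x → x ∈ M := fun x hx => M.mem_of_dvd hx hpM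
        have hiff : b - b₀ ∈ M ↔ b' - b₀ ∈ M := by
          have := Finset.ext_iff.mp heq M
          simpa [hMPP] using this
        have h2b : 2 * b₀ ∉ M := by
          intro h
          apply hM.ne_top
          rw [Ideal.eq_top_iff_one]
          have h1 := M.sub_mem (M.mul_mem_right v h) (hmem _ hv0)
          rwa [sub_sub_cancel] at h1
        have hpm : ∀ c ∈ Y, c - b₀ ∈ M ∨ c + b₀ ∈ M := by
          intro c hc
          have := hmem _ (hsq c hc b₀ hb₀)
          rw [sq_sub_sq] at this
          exact (hM.isPrime.mem_or_mem this).symm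
        by_cases h1 : b - b₀ ∈ M
        · have h2 := hiff.mp h1
          apply h2b
          have h3 := M.sub_mem (M.sub_mem hbM h1) h2
          convert h3 using 1
          ring
        · have h2 := fun h => h1 (hiff.mpr h)
          have h3 := (hpm b hb).resolve_left h1
          have h4 := (hpm b' hb').resolve_left h2
          apply h2b
          have h5 := M.sub_mem (M.add_mem h3 h4) hbM
          convert h5 using 1
          ring
      have h1 : (1 : 𝓞 F) ∈ Ideal.span {(p : 𝓞 F), b + b'} := by rw [htop]; trivial
      obtain ⟨x, z, hxz⟩ := Ideal.mem_span_pair.mp h1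
      have h2 : b - b' = (p : 𝓞 F) * (x * (b - b')) + z * (b ^ 2 - b' ^ 2) := by
        linear_combination -(b - b') * hxz
      rw [h2]
      exact dvd_add (dvd_mul_right _ _) (Dvd.dvd.mul_left (hsq b hb b' hb') _)
  refine key.trans ?_
  rw [Finset.card_powerset]
  exact Nat.pow_le_pow_right (by norm_num) hcard

lemma prime_count (F : Type) [Field F] [NumberField F] (p : ℕ) (hpp : p.Prime) (e : 𝓞 F) (he : e ≠ 0)
    (g : (𝓞 F)[X]) (m : ℕ) (hm : g.natDegree = m)
    (hgirr : Irreducible (g.map (algebraMap (𝓞 F) F))) (r : ℕ) (T : Finset (𝓞 F)) (y : 𝓞 F → 𝓞 F)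
    (hv : ∀ t ∈ T, ∃ v, (p : 𝓞 F) ∣ 2 * y t * v - 1)
    (hG : ∀ t ∈ T, (y t) ^ 2 = e * g.eval t) (B H : ℝ)
    (htB : ∀ t ∈ T, ∀ w : InfinitePlace F, w (t : F) ≤ 2 * B)
    (hyH : ∀ t ∈ T, ∀ w : InfinitePlace F, w (y t : F) ≤ H)
    (hp : ((r + r).factorial : ℝ) * ((2 * B) ^ (r * (r - 1)) * H ^ r) < (p : ℝ) ^ (r * (2 * r - 1))) :
    T.card ≤ (2 * r + m) * (2 ^ Module.finrank ℚ F * p ^ Module.finrank ℚ F) := by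
  classical
  let I : Ideal (𝓞 F) := Ideal.span {(p : 𝓞 F)}
  have hcardA : Nat.card (𝓞 F ⧸ I) = p ^ Module.finrank ℚ F := by
    rw [← absNorm_natCast_span, Ideal.absNorm_apply, Submodule.cardQuot_apply]
  have : Finite (𝓞 F ⧸ I) := Nat.finite_of_card_ne_zero (by rw [hcardA]; exact pow_ne_zero _ hpp.ne_zero)
  have : Fintype (𝓞 F ⧸ I) := Fintype.ofFinite _
  have hmk : ∀ a b : 𝓞 F, Ideal.Quotient.mk I a = Ideal.Quotient.mk I b ↔ (p : 𝓞 F) ∣ a - b := by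
    intro a b
    rw [Ideal.Quotient.eq, Ideal.mem_span_singleton]
  let Φ : 𝓞 F → (𝓞 F ⧸ I) × (𝓞 F ⧸ I) := fun t => (Ideal.Quotient.mk I t, Ideal.Quotient.mk I (y t))
  have h1 : T.card ≤ (2 * r + m) * (T.image Φ).card := by
    refine Finset.card_le_mul_card_image T _ fun z hz => ?_
    obtain ⟨t₀, ht₀, rfl⟩ := Finset.mem_image.mp hz
    obtain ⟨v, hv0⟩ := hv t₀ ht₀
    have hfib : ∀ t ∈ T.filter (fun t => Φ t = Φ t₀), t ∈ T ∧ (p : 𝓞 F) ∣ t - t₀ ∧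
        (p : 𝓞 F) ∣ y t - y t₀ := by
      intro t ht
      rw [Finset.mem_filter] at ht
      have h2 := Prod.ext_iff.mp ht.2
      exact ⟨ht.1, (hmk _ _).mp h2.1, (hmk _ _).mp h2.2⟩
    exact class_bound F p e he g m hm hgirr t₀ (y t₀) v hv0 r _ y
      (fun t ht => (hfib t ht).2.1) (fun t ht => (hfib t ht).2.2) (fun t ht => hG t (hfib t ht).1)
      B H (fun t ht => htB t (hfib t ht).1) (fun t ht => hyH t (hfib t ht).1) hp
  have h2 : (T.image Φ).card ≤ 2 ^ Module.finrank ℚ F * ((T.image Φ).image Prod.fst).card := by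
    refine Finset.card_le_mul_card_image _ _ fun a _ => ?_
    have hch : ∀ z : (𝓞 F ⧸ I) × (𝓞 F ⧸ I), ∃ t, z ∈ T.image Φ → t ∈ T ∧ Φ t = z := by
      intro z
      by_cases hz : z ∈ T.image Φ
      · obtain ⟨t, ht, h⟩ := Finset.mem_image.mp hz
        exact ⟨t, fun _ => ⟨ht, h⟩⟩
      · exact ⟨0, fun h => (hz h).elim⟩
    choose τ hτ using hch
    set Z := (T.image Φ).filter (fun z => z.1 = a) with hZ
    have hZτ : ∀ z ∈ Z, τ z ∈ T ∧ Ideal.Quotient.mk I (τ z) = a ∧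
        Ideal.Quotient.mk I (y (τ z)) = z.2 ∧ z.1 = a := by
      intro z hz
      rw [hZ, Finset.mem_filter] at hz
      have h3 := hτ z hz.1
      have h4 := Prod.ext_iff.mp h3.2
      exact ⟨h3.1, h4.1.trans hz.2, h4.2, hz.2⟩
    have hinj : ∀ z ∈ Z, ∀ z' ∈ Z, (p : 𝓞 F) ∣ y (τ z) - y (τ z') → z = z' := by
      intro z hz z' hz' h
      rw [← hmk, (hZτ z hz).2.2.1, (hZτ z' hz').2.2.1] at h
      exact Prod.ext ((hZτ z hz).2.2.2.trans (hZτ z' hz').2.2.2.symm) h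
    have hcz : Z.card = (Z.image (fun z => y (τ z))).card := by
      rw [Finset.card_image_of_injOn]
      intro z hz z' hz' h
      exact hinj z hz z' hz' (by simp only at h; rw [h, sub_self]; exact dvd_zero _)
    rw [hcz]
    refine sqrt_count F p hpp _ ?_ ?_ ?_
    · simp only [Finset.forall_mem_image]
      intro z hz
      exact hv _ (hZτ z hz).1
    · simp only [Finset.forall_mem_image]
      intro z hz z' hz'
      rw [hG _ (hZτ z hz).1, hG _ (hZτ z' hz').1, ← mul_sub]
      refine Dvd.dvd.mul_left (Dvd.dvd.trans ?_ (sub_dvd_eval_sub _ _ g)) _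
      rw [← hmk, (hZτ z hz).2.1, (hZτ z' hz').2.1]
    · simp only [Finset.forall_mem_image]
      intro z hz z' hz' h
      rw [hinj z hz z' hz' h]
  have h3 : ((T.image Φ).image Prod.fst).card ≤ p ^ Module.finrank ℚ F := by
    rw [← hcardA, Nat.card_eq_fintype_card]
    exact Finset.card_le_univ _
  calc _ ≤ _ := h1
    _ ≤ (2 * r + m) * (2 ^ Module.finrank ℚ F * p ^ Module.finrank ℚ F) := by
      gcongr
      exact h2.trans (Nat.mul_le_mul_left _ h3)

end detMethod3

end part_D3

section part_D4
open Polynomial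

section detMethod4

lemma exists_half_inv (F : Type) [Field F] [NumberField F] (p : ℕ) (hp : p.Prime) (hp2 : 2 < p)
    (y : 𝓞 F) (h : ¬ p ∣ Ideal.absNorm (Ideal.span {y})) :
    ∃ v, (p : 𝓞 F) ∣ 2 * y * v - 1 := by
  obtain ⟨z, hz⟩ := Ideal.mem_span_singleton.mp (Ideal.absNorm_mem (Ideal.span {y}))
  set N := Ideal.absNorm (Ideal.span {y})
  have hcop : Nat.Coprime (2 * N) p := by
    rw [Nat.coprime_comm, hp.coprime_iff_not_dvd, hp.dvd_mul]
    rintro (h2 | h2)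
    · exact absurd (Nat.le_of_dvd (by norm_num) h2) (by omega)
    · exact h h2
  obtain ⟨a, b, hab⟩ := Nat.isCoprime_iff_coprime.mpr hcop
  refine ⟨z * a, ⟨-b, ?_⟩⟩
  have h3 := congrArg (fun x : ℤ => (x : 𝓞 F)) hab
  push_cast at h3
  linear_combination -2 * (a : 𝓞 F) * hz + h3

lemma exists_primes (X : ℕ) (hX : X ≠ 0) :
    ∃ q : ℕ → ℕ, Function.Injective q ∧ ∀ i, (q i).Prime ∧ X * 2 ^ i < q i ∧ q i ≤ X * 2 ^ (i + 1) := by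
  have h : ∀ i, ∃ p, p.Prime ∧ X * 2 ^ i < p ∧ p ≤ X * 2 ^ (i + 1) := by
    intro i
    obtain ⟨p, hp, h1, h2⟩ := Nat.exists_prime_lt_and_le_two_mul (X * 2 ^ i) (by positivity)
    exact ⟨p, hp, h1, h2.trans (by rw [pow_succ]; linarith)⟩
  choose q hq using h
  refine ⟨q, StrictMono.injective (strictMono_nat_of_lt_succ fun i => ?_), hq⟩
  exact (hq i).2.2.trans_lt (hq (i + 1)).2.1

lemma absNorm_le_pow (F : Type) [Field F] [NumberField F] (y : 𝓞 F) (H : ℝ)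
    (h : ∀ w : InfinitePlace F, w (y : F) ≤ H) :
    (Ideal.absNorm (Ideal.span {y}) : ℝ) ≤ H ^ Module.finrank ℚ F := by
  have h1 := InfinitePlace.prod_eq_abs_norm (y : F)
  rw [← prod_place_eq F, Ideal.absNorm_span_singleton, Nat.cast_natAbs]
  have h2 : ((|Algebra.norm ℤ y| : ℤ) : ℝ) = ((|Algebra.norm ℚ (y : F)| : ℚ) : ℝ) := by
    rw [← Algebra.coe_norm_int]; simp
  rw [h2, ← h1]
  exact Finset.prod_le_prod (fun w _ => pow_nonneg (apply_nonneg _ _) _)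
    fun w _ => pow_le_pow_left₀ (apply_nonneg _ _) (h w) _

lemma rpow_ineq_aux (m r : ℕ) (hm : 1 ≤ m) (hr : r = 2 * m) (c₀ C₁ E₁ B p : ℝ) (hB : 1 ≤ B)
    (hE : 1 ≤ E₁) (hc₀ : c₀ = ((r + r).factorial : ℝ) * (2 ^ (r * (r - 1)) * E₁ ^ r)) (hC : c₀ < C₁)
    (hC1 : 1 ≤ C₁) (hp : C₁ * B ^ ((2 : ℝ) / 3) ≤ p) :
    ((r + r).factorial : ℝ) * ((2 * B) ^ (r * (r - 1)) * (E₁ * B ^ ((m : ℝ) / 2)) ^ r) <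
      p ^ (r * (2 * r - 1)) := by
  have hB0 : (0 : ℝ) < B := by linarith
  have hr1 : 1 ≤ r := by omega
  have e1 : ((r + r).factorial : ℝ) * ((2 * B) ^ (r * (r - 1)) * (E₁ * B ^ ((m : ℝ) / 2)) ^ r) =
      c₀ * B ^ (((r * (r - 1) : ℕ) : ℝ) + (m : ℝ) / 2 * r) := by
    rw [hc₀, mul_pow, mul_pow, Real.rpow_add hB0, Real.rpow_natCast, Real.rpow_mul hB0.le,
      Real.rpow_natCast]
    ring
  have e2 : (C₁ * B ^ ((2 : ℝ) / 3)) ^ (r * (2 * r - 1)) =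
      C₁ ^ (r * (2 * r - 1)) * B ^ ((2 : ℝ) / 3 * ((r * (2 * r - 1) : ℕ) : ℝ)) := by
    rw [mul_pow, Real.rpow_mul hB0.le, Real.rpow_natCast]
  have e3 : ((r * (r - 1) : ℕ) : ℝ) + (m : ℝ) / 2 * r ≤ (2 : ℝ) / 3 * ((r * (2 * r - 1) : ℕ) : ℝ) := by
    rw [Nat.cast_mul, Nat.cast_mul, Nat.cast_sub hr1, Nat.cast_sub (by omega : 1 ≤ 2 * r), hr]
    push_cast
    have : (1 : ℝ) ≤ m := by exact_mod_cast hm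
    nlinarith
  have e4 : C₁ ≤ C₁ ^ (r * (2 * r - 1)) := by
    apply le_self_pow₀ hC1
    have : 0 < r * (2 * r - 1) := Nat.mul_pos hr1 (by omega)
    omega
  calc _ = _ := e1
    _ < C₁ * B ^ (((r * (r - 1) : ℕ) : ℝ) + (m : ℝ) / 2 * r) := by gcongr
    _ ≤ C₁ ^ (r * (2 * r - 1)) * B ^ ((2 : ℝ) / 3 * ((r * (2 * r - 1) : ℕ) : ℝ)) := by
        gcongr
    _ = _ := e2.symm
    _ ≤ _ := by gcongr

lemma det_count (F : Type) [Field F] [NumberField F] (e : 𝓞 F) (he : e ≠ 0) (m : ℕ) (hm1 : 1 ≤ m)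
    (E₁ : ℝ) (hE : 1 ≤ E₁) : ∃ C : ℝ, 0 < C ∧ ∀ (g : (𝓞 F)[X]), g.natDegree = m →
      Irreducible (g.map (algebraMap (𝓞 F) F)) → ∀ B : ℝ, 1 ≤ B → ∀ (T : Finset (𝓞 F))
      (y : 𝓞 F → 𝓞 F), (∀ t ∈ T, (y t) ^ 2 = e * g.eval t) →
      (∀ t ∈ T, ∀ w : InfinitePlace F, w (t : F) ≤ 2 * B) →
      (∀ t ∈ T, ∀ w : InfinitePlace F, w (y t : F) ≤ E₁ * B ^ ((m : ℝ) / 2)) →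
      (T.card : ℝ) ≤ C * B ^ ((2 : ℝ) / 3 * Module.finrank ℚ F) := by
  classical
  set d := Module.finrank ℚ F with hd
  have hd1 : 0 < d := Module.finrank_pos
  obtain ⟨r, hr⟩ : ∃ r, r = 2 * m := ⟨_, rfl⟩
  obtain ⟨c₀, hc₀⟩ : ∃ c₀ : ℝ, c₀ = ((r + r).factorial : ℝ) * (2 ^ (r * (r - 1)) * E₁ ^ r) := ⟨_, rfl⟩
  have hc0pos : 0 ≤ c₀ := by rw [hc₀]; positivity
  set C₁ : ℝ := c₀ + 2 + E₁ with hC₁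
  set P : ℕ := d * m with hP
  set C : ℝ := m + P * ((2 * r + m) * (2 ^ d * (2 ^ (P + 1) * C₁) ^ d)) with hC
  have hmpos : (0 : ℝ) < m := by exact_mod_cast hm1
  refine ⟨C, by positivity, ?_⟩
  intro g hgm hgirr B hB T y hG htB hyH
  have hB0 : (0 : ℝ) < B := by linarith
  have hBp : 1 ≤ B ^ ((2 : ℝ) / 3) := Real.one_le_rpow hB (by norm_num)
  set X₀ : ℝ := C₁ * B ^ ((2 : ℝ) / 3) with hX₀
  have hX₀2 : 2 ≤ X₀ := by
    have : 2 ≤ C₁ := by rw [hC₁]; linarith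
    nlinarith
  set X : ℕ := ⌈X₀⌉₊ with hX
  have hXX : X₀ ≤ X := Nat.le_ceil _
  have hXX2 : (X : ℝ) ≤ 2 * X₀ := by
    have := Nat.ceil_lt_add_one (by linarith : 0 ≤ X₀)
    linarith
  have hXne : X ≠ 0 := by
    intro h
    rw [h] at hXX
    norm_num at hXX
    linarith
  obtain ⟨q, hqinj, hq⟩ := exists_primes X hXne
  have hqX : ∀ i, X₀ ≤ q i := by
    intro i
    have h1 : X ≤ q i := by
      calc X ≤ X * 2 ^ i := Nat.le_mul_of_pos_right _ (by positivity)
        _ ≤ q i := (hq i).2.1.le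
    have h2 : (X : ℝ) ≤ q i := by exact_mod_cast h1
    linarith
  have hq2 : ∀ i, 2 < q i := by
    intro i
    have h1 : 2 ≤ X := by
      have : (2 : ℝ) ≤ X := by linarith
      exact_mod_cast this
    have h2 := (hq i).2.1
    have h3 : X ≤ X * 2 ^ i := Nat.le_mul_of_pos_right _ (by positivity)
    omega
  let T0 := T.filter (fun t => y t = 0)
  let Ti : ℕ → Finset (𝓞 F) := fun i => T.filter (fun t => ¬ q i ∣ Ideal.absNorm (Ideal.span {y t}))
  have hcover : T ⊆ T0 ∪ (Finset.range P).biUnion Ti := by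
    intro t ht
    by_contra hcon
    rw [Finset.mem_union, not_or] at hcon
    obtain ⟨h0, h1⟩ := hcon
    have hy0 : y t ≠ 0 := fun h => h0 (Finset.mem_filter.mpr ⟨ht, h⟩)
    have hdvd : ∀ i ∈ Finset.range P, q i ∣ Ideal.absNorm (Ideal.span {y t}) := by
      intro i hi
      by_contra h
      exact h1 (Finset.mem_biUnion.mpr ⟨i, hi, Finset.mem_filter.mpr ⟨ht, h⟩⟩)
    have hprod : ∏ i ∈ Finset.range P, q i ∣ Ideal.absNorm (Ideal.span {y t}) := by
      refine Finset.prod_dvd_of_isRelPrime ?_ hdvd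
      intro i _ j _ hij
      have := (Nat.coprime_primes (hq i).1 (hq j).1).mpr (fun h => hij (hqinj h))
      exact Nat.coprime_iff_isRelPrime.mp this
    have hne : Ideal.absNorm (Ideal.span {y t}) ≠ 0 := by
      rw [Ne, Ideal.absNorm_eq_zero_iff, Ideal.span_singleton_eq_bot]
      exact hy0
    have hle := Nat.le_of_dvd (Nat.pos_of_ne_zero hne) hprod
    have hle2 : (∏ i ∈ Finset.range P, (q i : ℝ)) ≤ (E₁ * B ^ ((m : ℝ) / 2)) ^ d := by
      refine le_trans ?_ (absNorm_le_pow F (y t) _ (hyH t ht))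
      exact_mod_cast hle
    have hge : X₀ ^ P ≤ ∏ i ∈ Finset.range P, (q i : ℝ) := by
      rw [← Finset.card_range P, ← Finset.prod_const, Finset.card_range]
      exact Finset.prod_le_prod (fun _ _ => by linarith) fun i _ => hqX i
    have hlt : (E₁ * B ^ ((m : ℝ) / 2)) ^ d < X₀ ^ P := by
      rw [hP, mul_comm d m, pow_mul]
      refine pow_lt_pow_left₀ ?_ (by positivity) hd1.ne'
      rw [hX₀, mul_pow, ← Real.rpow_natCast (B ^ _), ← Real.rpow_mul hB0.le]
      have h5 : E₁ < C₁ ^ m := by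
        have h6 : C₁ ≤ C₁ ^ m := le_self_pow₀ (by rw [hC₁]; linarith) (by omega)
        have h7 : E₁ < C₁ := by rw [hC₁]; linarith
        linarith
      have h8 : B ^ ((m : ℝ) / 2) ≤ B ^ ((2 : ℝ) / 3 * m) :=
        Real.rpow_le_rpow_of_exponent_le hB (by linarith)
      have h9 : 0 < B ^ ((m : ℝ) / 2) := by positivity
      calc _ < C₁ ^ m * B ^ ((m : ℝ) / 2) := by gcongr
        _ ≤ _ := by
          have : 0 ≤ C₁ ^ m := by positivity
          gcongr
    linarith
  have hT0 : T0.card ≤ m := by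
    have hg0 : g.map (algebraMap (𝓞 F) F) ≠ 0 := hgirr.ne_zero
    have hg0' : g ≠ 0 := by rintro rfl; simp at hg0
    have hsub : T0 ⊆ g.roots.toFinset := by
      intro t ht
      rw [Finset.mem_filter] at ht
      rw [Multiset.mem_toFinset, mem_roots hg0', IsRoot.def]
      have := hG t ht.1
      rw [ht.2] at this
      simpa [he] using this.symm
    calc _ ≤ _ := Finset.card_le_card hsub
      _ ≤ _ := Multiset.toFinset_card_le _
      _ ≤ _ := card_roots' _
      _ = m := hgm
  have hTi : ∀ i ∈ Finset.range P, ((Ti i).card : ℝ) ≤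
      (2 * r + m) * (2 ^ d * (2 ^ (P + 1) * C₁) ^ d) * B ^ ((2 : ℝ) / 3 * d) := by
    intro i hi
    rw [Finset.mem_range] at hi
    have h1 := prime_count F (q i) (hq i).1 e he g m hgm hgirr r (Ti i) y
      (fun t ht => exists_half_inv F (q i) (hq i).1 (hq2 i) _ (Finset.mem_filter.mp ht).2)
      (fun t ht => hG t (Finset.mem_filter.mp ht).1) B (E₁ * B ^ ((m : ℝ) / 2))
      (fun t ht => htB t (Finset.mem_filter.mp ht).1)
      (fun t ht => hyH t (Finset.mem_filter.mp ht).1)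
      (rpow_ineq_aux m r hm1 hr c₀ C₁ E₁ B (q i) hB hE hc₀ (by rw [hC₁]; linarith)
        (by rw [hC₁]; linarith) (hqX i))
    have h2 : ((Ti i).card : ℝ) ≤ (2 * r + m) * (2 ^ d * (q i : ℝ) ^ d) := by exact_mod_cast h1
    have h3 : (q i : ℝ) ≤ 2 ^ (P + 1) * C₁ * B ^ ((2 : ℝ) / 3) := by
      have h4 : q i ≤ X * 2 ^ P :=
        (hq i).2.2.trans (Nat.mul_le_mul_left _ (Nat.pow_le_pow_right (by norm_num) hi))
      have h5 : (q i : ℝ) ≤ X * 2 ^ P := by exact_mod_cast h4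
      calc _ ≤ _ := h5
        _ ≤ 2 * X₀ * 2 ^ P := by gcongr
        _ = _ := by rw [hX₀]; ring
    refine h2.trans ?_
    rw [mul_assoc (2 * (r : ℝ) + m), mul_assoc ((2 : ℝ) ^ d)]
    gcongr
    rw [Real.rpow_mul hB0.le, Real.rpow_natCast, ← mul_pow]
    gcongr
  have hbig : 1 ≤ B ^ ((2 : ℝ) / 3 * d) := Real.one_le_rpow hB (by positivity)
  have hfin : T.card ≤ T0.card + ∑ i ∈ Finset.range P, (Ti i).card :=
    (Finset.card_le_card hcover).trans ((Finset.card_union_le _ _).trans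
      (Nat.add_le_add_left Finset.card_biUnion_le _))
  have hfin2 : (T.card : ℝ) ≤ T0.card + ∑ i ∈ Finset.range P, ((Ti i).card : ℝ) := by
    exact_mod_cast hfin
  have hT0' : (T0.card : ℝ) ≤ m := by exact_mod_cast hT0
  have hsum := Finset.sum_le_sum hTi
  rw [Finset.sum_const, Finset.card_range, nsmul_eq_mul] at hsum
  rw [hC, add_mul]
  have : (m : ℝ) ≤ m * B ^ ((2 : ℝ) / 3 * d) := by nlinarith
  have h9 : (P : ℝ) * ((2 * r + m) * (2 ^ d * (2 ^ (P + 1) * C₁) ^ d) * B ^ ((2 : ℝ) / 3 * d)) =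
    P * ((2 * r + m) * (2 ^ d * (2 ^ (P + 1) * C₁) ^ d)) * B ^ ((2 : ℝ) / 3 * d) := by ring
  linarith

end detMethod4

end part_D4


lemma units_mod_sq (F : Type) [Field F] [NumberField F] :
    ∃ R : Finset (𝓞 F)ˣ, ∀ u : (𝓞 F)ˣ, ∃ r ∈ R, ∃ v : (𝓞 F)ˣ, u = r * v ^ 2 := by
  classical
  haveI : Fintype (Units.torsion F) := Fintype.ofFinite _
  let f : Units.torsion F × (Fin (Units.rank F) → Fin 2) → (𝓞 F)ˣ := fun p =>
    (p.1 : (𝓞 F)ˣ) * ∏ i, (Units.fundSystem F i) ^ ((p.2 i : ℕ))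
  refine ⟨Finset.univ.image f, fun u => ?_⟩
  obtain ⟨⟨ζ, e⟩, h, -⟩ := Units.exist_unique_eq_mul_prod F u
  refine ⟨f (ζ, fun i => ⟨(e i % 2).toNat, by omega⟩), Finset.mem_image_of_mem _ (Finset.mem_univ _),
    ∏ i, (Units.fundSystem F i) ^ (e i / 2), ?_⟩
  simp only at h
  rw [h, mul_assoc, ← Finset.prod_pow, ← Finset.prod_mul_distrib]
  congr 1
  refine Finset.prod_congr rfl fun i _ => ?_
  rw [← zpow_natCast, ← zpow_natCast, ← zpow_mul, ← zpow_add]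
  congr 1
  simp only
  omega

lemma selmer_finite (F : Type) [Field F] [NumberField F] :
    ∃ E : Finset (𝓞 F), (∀ e ∈ E, e ≠ 0) ∧ ∀ x : 𝓞 F, x ≠ 0 → ∀ a : Ideal (𝓞 F),
      a ^ 2 = Ideal.span {x} → ∃ e ∈ E, ∃ w : 𝓞 F, w ^ 2 = e * x := by
  classical
  obtain ⟨R, hR⟩ := units_mod_sq F
  let P : ClassGroup (𝓞 F) → 𝓞 F → Prop := fun c x0 => x0 ≠ 0 ∧
    ∃ a : nonZeroDivisors (Ideal (𝓞 F)), ClassGroup.mk0 a = c ∧ (a : Ideal (𝓞 F)) ^ 2 = Ideal.span {x0}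
  let x0 : ClassGroup (𝓞 F) → 𝓞 F := fun c => if h : ∃ x, P c x then h.choose else 1
  have hx0 : ∀ c, x0 c ≠ 0 := by
    intro c
    by_cases h : ∃ x, P c x
    · simp only [x0, dif_pos h]
      exact h.choose_spec.1
    · simp only [x0, dif_neg h]
      exact one_ne_zero
  refine ⟨(Finset.univ ×ˢ R).image fun p => (p.2 : 𝓞 F) * x0 p.1, ?_, ?_⟩
  · intro e he
    obtain ⟨p, -, rfl⟩ := Finset.mem_image.mp he
    exact mul_ne_zero p.2.ne_zero (hx0 _)
  · intro x hx a ha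
    have ha0 : a ≠ ⊥ := by
      rintro rfl
      rw [← Ideal.zero_eq_bot, zero_pow two_ne_zero, eq_comm, Ideal.zero_eq_bot,
        Ideal.span_singleton_eq_bot] at ha
      exact hx ha
    let A : nonZeroDivisors (Ideal (𝓞 F)) := ⟨a, mem_nonZeroDivisors_of_ne_zero ha0⟩
    have hex : ∃ x, P (ClassGroup.mk0 A) x := ⟨x, hx, A, rfl, ha⟩
    have hP : P (ClassGroup.mk0 A) (x0 (ClassGroup.mk0 A)) := by
      simp only [x0, dif_pos hex]
      exact hex.choose_spec
    set y := x0 (ClassGroup.mk0 A)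
    obtain ⟨hy, b, hb, hb2⟩ := hP
    obtain ⟨μ, l, hμ, hl, hlm⟩ := ClassGroup.mk0_eq_mk0_iff.mp hb
    have h1 : Ideal.span {μ ^ 2 * y} = Ideal.span {l ^ 2 * x} := by
      rw [← Ideal.span_singleton_mul_span_singleton, ← Ideal.span_singleton_mul_span_singleton,
        ← Ideal.span_singleton_pow, ← Ideal.span_singleton_pow, ← hb2, ← ha, ← mul_pow, ← mul_pow,
        hlm]
    rw [Ideal.span_singleton_eq_span_singleton] at h1
    obtain ⟨u, hu⟩ := h1
    obtain ⟨r, hr, v, rfl⟩ := hR u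
    refine ⟨r * y, Finset.mem_image.mpr ⟨(ClassGroup.mk0 A, r), by simp [hr], rfl⟩, ?_⟩
    have key : (l : 𝓞 F) ^ 2 ∣ ((r : 𝓞 F) * v * μ * y) ^ 2 := by
      refine ⟨r * y * x, ?_⟩
      push_cast at hu
      linear_combination (r : 𝓞 F) * y * hu
    obtain ⟨w, hw⟩ := (IsIntegrallyClosed.pow_dvd_pow_iff two_ne_zero).mp key
    refine ⟨w, ?_⟩
    have : (l : 𝓞 F) ^ 2 ≠ 0 := pow_ne_zero _ hl
    apply mul_left_cancel₀ this
    push_cast at hu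
    rw [← mul_pow, ← hw]
    linear_combination (r : 𝓞 F) * y * hu


section C1
open Polynomial IntermediateField

lemma place_norm_le (F K : Type) [Field F] [NumberField F] [Field K] [NumberField K] [Algebra F K]
    (x : K) (B : ℝ) (h : ∀ w : InfinitePlace K, w x ≤ B) (w : InfinitePlace F) :
    w (Algebra.norm F x) ≤ B ^ Module.finrank F K := by
  let _ : Algebra F ℂ := w.embedding.toAlgebra
  have h1 := Algebra.norm_eq_prod_embeddings F ℂ x
  rw [← InfinitePlace.norm_embedding_eq]
  change ‖algebraMap F ℂ _‖ ≤ _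
  rw [h1, norm_prod, ← AlgHom.card F K ℂ, ← Finset.card_univ, ← Finset.prod_const]
  refine Finset.prod_le_prod ?_ ?_
  · intro _ _; positivity
  · intro σ _
    exact h (InfinitePlace.mk σ.toRingHom)

lemma norm_eq_eval (F K : Type) [Field F] [NumberField F] [Field K] [NumberField K] [Algebra F K]
    (x : K) (hx : F⟮x⟯ = ⊤) (t : F) :
    Algebra.norm F (x + algebraMap F K t) = (-1) ^ Module.finrank F K * (minpoly F x).eval (-t) := by
  have h1 : F⟮x + algebraMap F K t⟯ = ⊤ := by
    rw [Field.primitive_element_iff_minpoly_natDegree_eq] at hx ⊢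
    rw [minpoly.add_algebraMap, natDegree_comp, hx, natDegree_X_sub_C, mul_one]
  have hint : IsIntegral F (x + algebraMap F K t) := Algebra.IsIntegral.isIntegral _
  have h2 : Algebra.adjoin F {x + algebraMap F K t} = ⊤ := by
    refine Algebra.adjoin_eq_top_of_intermediateField ?_ h1
    intro y _
    exact Algebra.IsAlgebraic.isAlgebraic y
  have h3 := Algebra.PowerBasis.norm_gen_eq_coeff_zero_minpoly (PowerBasis.ofAdjoinEqTop hint h2)
  rw [PowerBasis.ofAdjoinEqTop_gen, ← PowerBasis.finrank, minpoly.add_algebraMap] at h3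
  rw [h3, coeff_zero_eq_eval_zero, eval_comp]
  simp

lemma span_eval_eq (F K : Type) [Field F] [NumberField F] [Field K] [NumberField K] [Algebra F K]
    (a : 𝓞 K) (hx : F⟮(a : K)⟯ = ⊤) (t : 𝓞 F) :
    Ideal.span {(minpoly (𝓞 F) a).eval (-t)} =
      Ideal.relNorm (𝓞 F) (Ideal.span {a + algebraMap (𝓞 F) (𝓞 K) t}) ∧
    ∀ B : ℝ, (∀ w : InfinitePlace K, w ((a + algebraMap (𝓞 F) (𝓞 K) t : 𝓞 K) : K) ≤ B) →
      ∀ w : InfinitePlace F, w (((minpoly (𝓞 F) a).eval (-t) : 𝓞 F) : F) ≤ B ^ Module.finrank F K := by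
  have h0 : algebraMap (𝓞 F) F ((minpoly (𝓞 F) a).eval (-t)) = (minpoly F (a : K)).eval (-(t : F)) := by
    have : minpoly F (a : K) = (minpoly (𝓞 F) a).map (algebraMap (𝓞 F) F) :=
      minpoly.isIntegrallyClosed_eq_field_fractions F K (Algebra.IsIntegral.isIntegral a)
    rw [this, eval_map, ← map_neg, eval₂_at_apply]
  have hc : ((a + algebraMap (𝓞 F) (𝓞 K) t : 𝓞 K) : K) = (a : K) + algebraMap F K t := by
    change algebraMap (𝓞 K) K _ = _
    rw [map_add]
    rfl
  have h1 := norm_eq_eval F K a hx t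
  rw [← h0] at h1
  have h2 : algebraMap (𝓞 F) F (Algebra.intNorm (𝓞 F) (𝓞 K) (a + algebraMap (𝓞 F) (𝓞 K) t)) =
      Algebra.norm F ((a + algebraMap (𝓞 F) (𝓞 K) t : 𝓞 K) : K) :=
    Algebra.algebraMap_intNorm (L := K) _
  constructor
  · rw [Ideal.relNorm_singleton, Ideal.span_singleton_eq_span_singleton]
    refine ⟨(-1) ^ Module.finrank F K, ?_⟩
    apply RingOfIntegers.coe_injective
    rw [h2, hc, h1]
    simp [mul_comm]
  · intro B hB w
    have h3 := place_norm_le F K _ B hB w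
    have h4 : w (-1 : F) = 1 := by
      rw [← InfinitePlace.norm_embedding_eq]
      simp
    rw [hc, h1, map_mul, map_pow, h4, one_pow, one_mul] at h3
    exact h3

lemma exists_box_points (F : Type) [Field F] [NumberField F] :
    ∃ c : ℝ, 0 < c ∧ ∀ B : ℝ, 1 ≤ B → ∃ U : Finset (𝓞 F),
      (∀ u ∈ U, ∀ w : InfinitePlace F, w (u : F) ≤ B) ∧ c * B ^ Module.finrank ℚ F ≤ U.card := by
  classical
  let b := RingOfIntegers.basis F
  let M : ℝ := ∑ i, ∑ w : InfinitePlace F, w (b i : F) + 1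
  have hM0 : ∀ w : InfinitePlace F, ∑ i, w (b i : F) ≤ M := by
    intro w
    have : ∑ i, w (b i : F) ≤ ∑ i, ∑ w : InfinitePlace F, w (b i : F) :=
      Finset.sum_le_sum fun i _ => Finset.single_le_sum (f := fun w : InfinitePlace F => w (b i : F))
        (fun _ _ => apply_nonneg _ _) (Finset.mem_univ w)
    linarith
  have hMp : 0 < M := by
    have : 0 ≤ ∑ i, ∑ w : InfinitePlace F, w (b i : F) :=
      Finset.sum_nonneg fun i _ => Finset.sum_nonneg fun _ _ => apply_nonneg _ _
    linarith
  refine ⟨(1 / M) ^ Module.finrank ℚ F, by positivity, fun B hB => ?_⟩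
  let N := ⌊B / M⌋₊
  let f : (Module.Free.ChooseBasisIndex ℤ (𝓞 F) → Fin (N + 1)) → 𝓞 F := fun a => ∑ i, ((a i : ℕ) : ℤ) • b i
  refine ⟨Finset.univ.image f, ?_, ?_⟩
  · intro u hu w
    obtain ⟨a, -, rfl⟩ := Finset.mem_image.mp hu
    have h1 : ((f a : 𝓞 F) : F) = ∑ i, ((a i : ℕ) : F) * (b i : F) := by
      simp [f]
    rw [h1]
    have hN : (N : ℝ) * M ≤ B := by
      have := Nat.floor_le (show 0 ≤ B / M by positivity)
      rwa [le_div_iff₀ hMp] at this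
    calc w (∑ i, ((a i : ℕ) : F) * (b i : F)) ≤ ∑ i, w (((a i : ℕ) : F) * (b i : F)) := by
          rw [← InfinitePlace.norm_embedding_eq, map_sum]
          refine (norm_sum_le _ _).trans (le_of_eq ?_)
          exact Finset.sum_congr rfl fun i _ => InfinitePlace.norm_embedding_eq _ _
      _ ≤ ∑ i, (N : ℝ) * w (b i : F) := by
          refine Finset.sum_le_sum fun i _ => ?_
          rw [map_mul]
          gcongr
          rw [← InfinitePlace.norm_embedding_eq, map_natCast, Complex.norm_natCast]
          exact_mod_cast Nat.lt_succ_iff.mp (a i).2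
      _ = N * ∑ i, w (b i : F) := by rw [Finset.mul_sum]
      _ ≤ N * M := by gcongr; exact hM0 w
      _ ≤ B := hN
  · rw [Finset.card_image_of_injective, Finset.card_univ, Fintype.card_fun, Fintype.card_fin,
      ← Module.finrank_eq_card_basis b, RingOfIntegers.rank, ← mul_pow]
    · push_cast
      gcongr
      rw [one_div_mul_eq_div]
      exact (Nat.lt_floor_add_one _).le
    · intro a a' h
      have h1 : b.equivFun.symm (fun i => ((a i : ℕ) : ℤ)) = b.equivFun.symm (fun i => ((a' i : ℕ) : ℤ)) := by
        rw [Module.Basis.equivFun_symm_apply, Module.Basis.equivFun_symm_apply]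
        exact h
      have h2 := b.equivFun.symm.injective h1
      funext i
      have := congrFun h2 i
      apply Fin.ext
      exact_mod_cast this
end C1


section C2
open Polynomial IntermediateField

lemma fiber_bound (F : Type) [Field F] [NumberField F] (m : ℕ) (hm : 1 ≤ m) :
    ∃ C : ℝ, 0 < C ∧ ∀ (K : Type) [Field K] [NumberField K] [Algebra F K], Module.finrank F K = m →
      ∀ a : 𝓞 K, F⟮(a : K)⟯ = ⊤ → ∀ B : ℝ, 1 ≤ B → ∀ T : Finset (𝓞 F),
      (∀ t ∈ T, a + algebraMap (𝓞 F) (𝓞 K) t ≠ 0) →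
      (∀ t ∈ T, ∃ J : Ideal (𝓞 K), J ^ 2 = Ideal.span {a + algebraMap (𝓞 F) (𝓞 K) t}) →
      (∀ t ∈ T, ∀ w : InfinitePlace K, w ((a + algebraMap (𝓞 F) (𝓞 K) t : 𝓞 K) : K) ≤ B) →
      (∀ t ∈ T, ∀ w : InfinitePlace F, w (t : F) ≤ 2 * B) →
      (T.card : ℝ) ≤ C * B ^ ((2 : ℝ) / 3 * Module.finrank ℚ F) := by
  classical
  obtain ⟨E, hE0, hE⟩ := selmer_finite F
  let E₁ : ℝ := ∑ e ∈ E, ∑ w : InfinitePlace F, w (e : F) + 1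
  have hE1' : ∀ e ∈ E, ∀ w : InfinitePlace F, w (e : F) ≤ E₁ := by
    intro e he w
    have h1 : w (e : F) ≤ ∑ w : InfinitePlace F, w (e : F) :=
      Finset.single_le_sum (f := fun w : InfinitePlace F => w (e : F))
        (fun _ _ => apply_nonneg _ _) (Finset.mem_univ w)
    have h2 : ∑ w : InfinitePlace F, w (e : F) ≤ ∑ e ∈ E, ∑ w : InfinitePlace F, w (e : F) :=
      Finset.single_le_sum (f := fun e : 𝓞 F => ∑ w : InfinitePlace F, w (e : F))
        (fun _ _ => Finset.sum_nonneg fun _ _ => apply_nonneg _ _) he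
    linarith
  have hE1 : 1 ≤ E₁ := by
    have : 0 ≤ ∑ e ∈ E, ∑ w : InfinitePlace F, w (e : F) :=
      Finset.sum_nonneg fun i _ => Finset.sum_nonneg fun _ _ => apply_nonneg _ _
    linarith
  have hdc := fun (e : {e // e ∈ E}) => det_count F e.1 (hE0 e.1 e.2) m hm E₁ hE1
  choose C hC0 hC using hdc
  refine ⟨∑ e, C e + 1, ?_, ?_⟩
  · have : 0 ≤ ∑ e, C e := Finset.sum_nonneg fun e _ => (hC0 e).le
    linarith
  intro K _ _ _ hK a ha B hB T hT0 hTJ hTB hT2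
  let g := minpoly (𝓞 F) a
  have hg : minpoly F (a : K) = g.map (algebraMap (𝓞 F) F) :=
    minpoly.isIntegrallyClosed_eq_field_fractions F K (Algebra.IsIntegral.isIntegral a)
  have hgm : g.Monic := minpoly.monic (Algebra.IsIntegral.isIntegral a)
  have hgd : g.natDegree = m := by
    rw [← hgm.natDegree_map (algebraMap (𝓞 F) F), ← hg,
      (Field.primitive_element_iff_minpoly_natDegree_eq F (a : K)).mp ha, hK]
  have hgi : Irreducible (g.map (algebraMap (𝓞 F) F)) := by
    rw [← hg]
    exact minpoly.irreducible (Algebra.IsIntegral.isIntegral _)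
  let T' := T.image (fun t => -t)
  have hT'card : T'.card = T.card := Finset.card_image_of_injective _ neg_injective
  have hT' : ∀ s ∈ T', ∃ t ∈ T, s = -t := by
    intro s hs
    obtain ⟨t, ht, rfl⟩ := Finset.mem_image.mp hs
    exact ⟨t, ht, rfl⟩
  let Q : 𝓞 F → 𝓞 F → Prop := fun e s => ∃ y : 𝓞 F, y ^ 2 = e * g.eval s
  have hcov : ∀ s ∈ T', ∃ e ∈ E, Q e s := by
    intro s hs
    obtain ⟨t, ht, rfl⟩ := hT' s hs
    obtain ⟨J, hJ⟩ := hTJ t ht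
    have h1 := (span_eval_eq F K a ha t).1
    rw [← hJ, map_pow] at h1
    refine hE _ ?_ _ h1.symm
    intro h2
    have h3 := (span_eval_eq F K a ha t).1
    rw [h2, Ideal.span_singleton_eq_bot.mpr rfl, eq_comm, Ideal.relNorm_eq_bot_iff,
      Ideal.span_singleton_eq_bot] at h3
    exact hT0 t ht h3
  have hsub : T' ⊆ E.attach.biUnion fun e => T'.filter (Q e.1) := by
    intro s hs
    obtain ⟨e, he, hq⟩ := hcov s hs
    exact Finset.mem_biUnion.mpr ⟨⟨e, he⟩, Finset.mem_attach _ _, Finset.mem_filter.mpr ⟨hs, hq⟩⟩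
  have hone : ∀ e : {e // e ∈ E}, ((T'.filter (Q e.1)).card : ℝ) ≤
      C e * B ^ ((2 : ℝ) / 3 * Module.finrank ℚ F) := by
    intro e
    let y : 𝓞 F → 𝓞 F := fun s => if h : Q e.1 s then h.choose else 0
    have hy : ∀ s ∈ T'.filter (Q e.1), (y s) ^ 2 = e.1 * g.eval s := by
      intro s hs
      have hq := (Finset.mem_filter.mp hs).2
      simp only [y, dif_pos hq]
      exact hq.choose_spec
    refine hC e g hgd hgi B hB _ y hy ?_ ?_
    · intro s hs w
      obtain ⟨t, ht, rfl⟩ := hT' s (Finset.mem_filter.mp hs).1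
      have h4 : w ((-t : 𝓞 F) : F) = w (t : F) := by
        rw [← InfinitePlace.norm_embedding_eq, ← InfinitePlace.norm_embedding_eq]
        simp
      rw [h4]
      exact hT2 t ht w
    · intro s hs w
      have hys := hy s hs
      obtain ⟨t, ht, rfl⟩ := hT' s (Finset.mem_filter.mp hs).1
      have hb := (span_eval_eq F K a ha t).2 B (hTB t ht) w
      rw [hK] at hb
      have h5 : (w ((y (-t) : 𝓞 F) : F)) ^ 2 = w (e.1 : F) * w ((g.eval (-t) : 𝓞 F) : F) := by
        rw [← map_pow, ← map_mul, ← map_pow, hys, map_mul]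
      have hB0 : 0 < B := by linarith
      refine abs_le_of_sq_le_sq' ?_ (by positivity) |>.2
      rw [h5, mul_pow, ← Real.rpow_natCast (B ^ _), ← Real.rpow_mul hB0.le]
      have h6 : (m : ℝ) / 2 * (2 : ℕ) = m := by push_cast; ring
      rw [h6, Real.rpow_natCast]
      have h7 : w (e.1 : F) ≤ E₁ ^ 2 := (hE1' e.1 e.2 w).trans (le_self_pow₀ hE1 two_ne_zero)
      gcongr
  have hfin : (T'.card : ℝ) ≤ ∑ e : {e // e ∈ E}, ((T'.filter (Q e.1)).card : ℝ) := by
    have h8 := (Finset.card_le_card hsub).trans Finset.card_biUnion_le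
    exact_mod_cast h8
  rw [← hT'card]
  have hB0 : 0 < B := by linarith
  calc (T'.card : ℝ) ≤ _ := hfin
    _ ≤ ∑ e, C e * B ^ ((2 : ℝ) / 3 * Module.finrank ℚ F) := Finset.sum_le_sum fun e _ => hone e
    _ = (∑ e, C e) * B ^ ((2 : ℝ) / 3 * Module.finrank ℚ F) := by rw [Finset.sum_mul]
    _ ≤ _ := by gcongr; linarith
end C2


section C3
open IntermediateField

lemma place_algebraMap_le (F K : Type) [Field F] [NumberField F] [Field K] [NumberField K] [Algebra F K]
    (t : F) (R : ℝ) (h : ∀ w : InfinitePlace K, w (algebraMap F K t) ≤ R) (w : InfinitePlace F) :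
    w t ≤ R := by
  obtain ⟨v, rfl⟩ := InfinitePlace.comap_surjective (K := K) w
  exact h v

lemma place_algebraMap_le' (F K : Type) [Field F] [NumberField F] [Field K] [NumberField K] [Algebra F K]
    (t : F) (R : ℝ) (h : ∀ w : InfinitePlace F, w t ≤ R) (w : InfinitePlace K) :
    w (algebraMap F K t) ≤ R := h (w.comap (algebraMap F K))

lemma place_add_le (K : Type) [Field K] [NumberField K] (w : InfinitePlace K) (x y : K) :
    w (x + y) ≤ w x + w y := by
  simp only [← InfinitePlace.norm_embedding_eq, map_add]
  exact norm_add_le _ _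

lemma place_sub_le (K : Type) [Field K] [NumberField K] (w : InfinitePlace K) (x y : K) :
    w (x - y) ≤ w x + w y := by
  simp only [← InfinitePlace.norm_embedding_eq, map_sub]
  exact norm_sub_le _ _

lemma coset_count (F : Type) [Field F] [NumberField F] (m : ℕ) (hm : 1 ≤ m) :
    ∃ C : ℝ, 0 < C ∧ ∀ (K : Type) [Field K] [NumberField K] [Algebra F K], Module.finrank F K = m →
      ∀ S : Finset (𝓞 K), (∀ α ∈ S, α ≠ 0 ∧ F⟮(α : K)⟯ = ⊤ ∧ (∃ J : Ideal (𝓞 K), J ^ 2 = Ideal.span {α}) ∧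
        ∀ w : InfinitePlace K, w (α : K) ≤ boxR K) →
      ∃ N : ℕ, (S.card : ℝ) ≤ C * boxR K ^ ((2 : ℝ) / 3 * Module.finrank ℚ F) * N ∧
        C⁻¹ * boxR K ^ Module.finrank ℚ F * N ≤ (4 * (6 * Module.finrank ℚ K : ℝ) ^ Module.finrank ℚ K *
          2 ^ Module.finrank ℚ K * 4 ^ (Module.finrank ℚ K + 1)) * √|(discr K : ℝ)| := by
  classical
  obtain ⟨C₁, hC₁, hfib⟩ := fiber_bound F m hm
  obtain ⟨c, hc, hbox⟩ := exists_box_points F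
  refine ⟨max C₁ c⁻¹, by positivity, ?_⟩
  intro K _ _ _ hK S hS
  set B := boxR K with hBdef
  have hB : 1 ≤ B := one_le_boxR K
  have hB0 : 0 < B := by linarith
  let H : AddSubgroup (𝓞 K) := (algebraMap (𝓞 F) (𝓞 K)).toAddMonoidHom.range
  have hH : ∀ x, x ∈ H ↔ ∃ t, algebraMap (𝓞 F) (𝓞 K) t = x := fun x => by
    simp only [H, AddMonoidHom.mem_range]; rfl
  let q : 𝓞 K → 𝓞 K ⧸ H := fun x => (x : 𝓞 K ⧸ H)
  have hq : ∀ x y, q x = q y ↔ ∃ t, algebraMap (𝓞 F) (𝓞 K) t = y - x := by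
    intro x y
    rw [← hH]
    simp only [q]
    rw [QuotientAddGroup.eq, neg_add_eq_sub]
  have hinj : Function.Injective (algebraMap (𝓞 F) (𝓞 K)) :=
    FaithfulSMul.algebraMap_injective _ _
  have hcoe : ∀ t : 𝓞 F, ((algebraMap (𝓞 F) (𝓞 K) t : 𝓞 K) : K) = algebraMap F K t := fun t => rfl
  refine ⟨(S.image q).card, ?_, ?_⟩
  · have hX : S.card ≤ ⌊C₁ * B ^ ((2 : ℝ) / 3 * Module.finrank ℚ F)⌋₊ * (S.image q).card := by
      refine Finset.card_le_mul_card_image S _ ?_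
      intro b hb
      obtain ⟨a, ha, rfl⟩ := Finset.mem_image.mp hb
      apply Nat.le_floor
      let A := S.filter (fun x => q x = q a)
      have hA : ∀ x ∈ A, ∃ t, algebraMap (𝓞 F) (𝓞 K) t = x - a := fun x hx =>
        (hq a x).mp ((Finset.mem_filter.mp hx).2).symm
      let T : Finset (𝓞 F) := A.preimage (fun t => a + algebraMap (𝓞 F) (𝓞 K) t)
        (fun x _ y _ h => hinj (add_left_cancel h))
      have hTA : A = T.image (fun t => a + algebraMap (𝓞 F) (𝓞 K) t) := by
        ext x
        simp only [Finset.mem_image]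
        constructor
        · intro hx
          obtain ⟨t, ht⟩ := hA x hx
          have : a + algebraMap (𝓞 F) (𝓞 K) t = x := by rw [ht]; ring
          exact ⟨t, Finset.mem_preimage.mpr (by rw [this]; exact hx), this⟩
        · rintro ⟨t, ht, rfl⟩
          exact (Finset.mem_preimage (f := fun t => a + algebraMap (𝓞 F) (𝓞 K) t)).mp ht
      have hTm : ∀ t ∈ T, a + algebraMap (𝓞 F) (𝓞 K) t ∈ S := fun t ht =>
        (Finset.mem_filter.mp (Finset.mem_preimage.mp ht)).1
      have hcard : A.card = T.card := by
        rw [hTA]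
        exact Finset.card_image_of_injective _ (fun x y h => hinj (add_left_cancel h))
      change (A.card : ℝ) ≤ _
      rw [hcard]
      refine hfib K hK a (hS a ha).2.1 B hB T (fun t ht => (hS _ (hTm t ht)).1)
        (fun t ht => (hS _ (hTm t ht)).2.2.1) (fun t ht => (hS _ (hTm t ht)).2.2.2) ?_
      intro t ht w
      refine place_algebraMap_le F K t _ ?_ w
      intro v
      have h1 := (hS _ (hTm t ht)).2.2.2 v
      have h2 := (hS a ha).2.2.2 v
      have h3 : algebraMap F K t = ((a + algebraMap (𝓞 F) (𝓞 K) t : 𝓞 K) : K) - (a : K) := by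
        rw [← hcoe, ← map_sub, add_sub_cancel_left]
      rw [h3]
      linarith [place_sub_le K v ((a + algebraMap (𝓞 F) (𝓞 K) t : 𝓞 K) : K) (a : K)]
    have hX' : (S.card : ℝ) ≤ (⌊C₁ * B ^ ((2 : ℝ) / 3 * Module.finrank ℚ F)⌋₊ : ℝ) * (S.image q).card := by
      exact_mod_cast hX
    refine hX'.trans ?_
    gcongr
    refine (Nat.floor_le (by positivity)).trans ?_
    gcongr
    exact le_max_left _ _
  · obtain ⟨U, hU, hUc⟩ := hbox B hB
    have hsec : ∀ b : 𝓞 K ⧸ H, ∃ s : 𝓞 K, b ∈ S.image q → s ∈ S ∧ q s = b := by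
      intro b
      by_cases hb : b ∈ S.image q
      · obtain ⟨s, hs, h⟩ := Finset.mem_image.mp hb
        exact ⟨s, fun _ => ⟨hs, h⟩⟩
      · exact ⟨0, fun h => absurd h hb⟩
    choose sec hsec using hsec
    let W : Finset (𝓞 K) := (S.image q ×ˢ U).image fun p => sec p.1 + algebraMap (𝓞 F) (𝓞 K) p.2
    have hW : W.card = (S.image q).card * U.card := by
      rw [← Finset.card_product]
      apply Finset.card_image_of_injOn
      rintro ⟨b, u⟩ hp ⟨b', u'⟩ hp' h
      have hp1 := Finset.mem_product.mp (Finset.mem_coe.mp hp)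
      have hp1' := Finset.mem_product.mp (Finset.mem_coe.mp hp')
      simp only at h hp1 hp1'
      have hbb : b = b' := by
        rw [← (hsec b hp1.1).2, ← (hsec b' hp1'.1).2, hq]
        refine ⟨u - u', ?_⟩
        rw [map_sub]
        linear_combination h
      subst hbb
      have : u = u' := hinj (add_left_cancel h)
      rw [this]
    have hWbox : ∀ x ∈ W, ∀ w : InfinitePlace K, w (x : K) ≤ 2 * B := by
      intro x hx w
      obtain ⟨⟨b, u⟩, hp, rfl⟩ := Finset.mem_image.mp hx
      have hp1 := Finset.mem_product.mp hp
      have h1 := (hS _ (hsec b hp1.1).1).2.2.2 w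
      have h2 := place_algebraMap_le' F K (u : F) B (hU u hp1.2) w
      change w (algebraMap (𝓞 K) K _) ≤ _
      rw [map_add]
      refine (place_add_le K w _ _).trans ?_
      exact (add_le_add h1 h2).trans (by linarith)
    have hBn := boxR_pow K
    rw [← hBdef] at hBn
    have hD1 := one_le_abs_discr K
    have hlat := lattice_count K (2 * B) (by positivity) (by
      rw [mul_pow, hBn]
      have h1 : (1 : ℝ) ≤ 2 ^ Module.finrank ℚ K := one_le_pow₀ (by norm_num)
      have h2 : (1 : ℝ) ≤ 4 ^ (Module.finrank ℚ K + 1) := one_le_pow₀ (by norm_num)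
      have h3 : (1 : ℝ) ≤ 2 ^ Module.finrank ℚ K * 4 ^ (Module.finrank ℚ K + 1) := one_le_mul_of_one_le_of_one_le h1 h2
      calc |(discr K : ℝ)| = 1 * |(discr K : ℝ)| := (one_mul _).symm
        _ ≤ (2 ^ Module.finrank ℚ K * 4 ^ (Module.finrank ℚ K + 1)) * |(discr K : ℝ)| := by gcongr
        _ = _ := by ring) W hWbox
    rw [hW, mul_pow 2 B, hBn] at hlat
    set D := |(discr K : ℝ)|
    have hs : √D * √D = D := Real.mul_self_sqrt (by linarith)
    have hs0 : 0 < √D := Real.sqrt_pos.mpr (by linarith)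
    have hlat2 : ((S.image q).card : ℝ) * U.card ≤ (4 * (6 * Module.finrank ℚ K : ℝ) ^ Module.finrank ℚ K *
          2 ^ Module.finrank ℚ K * 4 ^ (Module.finrank ℚ K + 1)) * √D := by
      refine le_of_mul_le_mul_right ?_ hs0
      push_cast at hlat
      refine hlat.trans (le_of_eq ?_)
      rw [mul_assoc _ (√D) (√D), hs]
      ring
    refine le_trans ?_ hlat2
    have hcc : (max C₁ c⁻¹)⁻¹ ≤ c := by
      rw [inv_le_comm₀ (by positivity) hc]
      exact le_max_right _ _
    calc (max C₁ c⁻¹)⁻¹ * B ^ Module.finrank ℚ F * (S.image q).card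
        ≤ c * B ^ Module.finrank ℚ F * (S.image q).card := by gcongr
      _ ≤ U.card * (S.image q).card := by gcongr
      _ = _ := mul_comm _ _

lemma good_count (F : Type) [Field F] [NumberField F] (hF : 2 ≤ Module.finrank ℚ F) (n : ℕ) (hn : 1 ≤ n) :
    ∃ C : ℝ, 0 < C ∧ ∀ (K : Type) [Field K] [NumberField K] [Algebra F K], Module.finrank ℚ K = n →
      ∀ S : Finset (𝓞 K), (∀ α ∈ S, α ≠ 0 ∧ F⟮(α : K)⟯ = ⊤ ∧ (∃ J : Ideal (𝓞 K), J ^ 2 = Ideal.span {α}) ∧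
        ∀ w : InfinitePlace K, w (α : K) ≤ boxR K) →
      (S.card : ℝ) ≤ C * |(discr K : ℝ)| ^ ((1 : ℝ) / 2 - 2 / (3 * n)) := by
  classical
  set d := Module.finrank ℚ F with hd
  by_cases hdn : d ≤ n
  swap
  · refine ⟨1, one_pos, fun K _ _ _ hK => ?_⟩
    exfalso
    have := Module.finrank_mul_finrank ℚ F K
    have h1 : 0 < Module.finrank F K := Module.finrank_pos
    nlinarith
  obtain ⟨C, hC, h⟩ := coset_count F (n / d) (Nat.div_pos hdn (by omega))
  set c₁ : ℝ := 4 * (6 * n : ℝ) ^ n * 2 ^ n * 4 ^ (n + 1) with hc₁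
  have hnpos : (0 : ℝ) < n := by exact_mod_cast hn
  refine ⟨C * C * c₁, by positivity, ?_⟩
  intro K _ _ _ hK S hS
  have hm : Module.finrank F K = n / d := by
    have := Module.finrank_mul_finrank ℚ F K
    rw [hK] at this
    rw [← this, Nat.mul_div_cancel_left _ (by omega)]
  obtain ⟨N, h1, h2⟩ := h K hm S hS
  rw [hK, ← hc₁] at h2
  set B := boxR K with hBdef
  have hB : 1 ≤ B := one_le_boxR K
  have hB0 : 0 < B := by linarith
  have hBn := boxR_pow K
  rw [← hBdef, hK] at hBn
  have hD1 := one_le_abs_discr K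
  set D := |(discr K : ℝ)|
  have hD0 : 0 < D := by linarith
  have hBD : D ^ ((1 : ℝ) / n) ≤ B := by
    have h3 : D ≤ B ^ n := by
      rw [hBn]
      exact le_mul_of_one_le_left hD0.le (one_le_pow₀ (by norm_num))
    calc D ^ ((1 : ℝ) / n) ≤ (B ^ n) ^ ((1 : ℝ) / n) := by gcongr
      _ = B := by
        rw [one_div]
        exact Real.pow_rpow_inv_natCast hB0.le (by omega)
  have hB23 : D ^ ((2 : ℝ) / (3 * n)) ≤ B ^ ((d : ℝ) / 3) := by
    calc D ^ ((2 : ℝ) / (3 * n)) = (D ^ ((1 : ℝ) / n)) ^ ((2 : ℝ) / 3) := by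
          rw [← Real.rpow_mul hD0.le]
          congr 1
          field_simp
      _ ≤ B ^ ((2 : ℝ) / 3) := by gcongr
      _ ≤ B ^ ((d : ℝ) / 3) := by
          apply Real.rpow_le_rpow_of_exponent_le hB
          have : (2 : ℝ) ≤ d := by exact_mod_cast hF
          linarith
  have hsplit : B ^ d = B ^ ((2 : ℝ) / 3 * d) * B ^ ((d : ℝ) / 3) := by
    rw [← Real.rpow_add hB0, ← Real.rpow_natCast]
    congr 1
    ring
  have hDs : D ^ ((1 : ℝ) / 2 - 2 / (3 * n)) * D ^ ((2 : ℝ) / (3 * n)) = √D := by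
    rw [← Real.rpow_add hD0, Real.sqrt_eq_rpow]
    congr 1
    ring
  have hfin : (S.card : ℝ) * D ^ ((2 : ℝ) / (3 * n)) ≤ C * C * c₁ * √D := by
    calc (S.card : ℝ) * D ^ ((2 : ℝ) / (3 * n))
        ≤ (C * B ^ ((2 : ℝ) / 3 * d) * N) * B ^ ((d : ℝ) / 3) := by gcongr
      _ = C * C * (C⁻¹ * B ^ d * N) := by rw [hsplit]; field_simp
      _ ≤ C * C * (c₁ * √D) := by gcongr
      _ = _ := by ring
  rw [← hDs, ← mul_assoc] at hfin
  exact le_of_mul_le_mul_right hfin (by positivity)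
end C3


section F1

lemma divisor_bound (δ : ℝ) (hδ : 0 < δ) : ∃ C : ℝ, 1 ≤ C ∧ ∀ y : ℕ, y ≠ 0 →
    (y.divisors.card : ℝ) ≤ C * (y : ℝ) ^ δ := by
  obtain ⟨P, hP⟩ := exists_nat_gt ((2 : ℝ) ^ (1 / δ))
  let C₀ : ℝ := max 1 (1 / (δ * Real.log 2))
  have hl : 0 < Real.log 2 := Real.log_pos (by norm_num)
  have hC0 : 1 ≤ C₀ := le_max_left _ _
  refine ⟨C₀ ^ P, one_le_pow₀ hC0, fun y hy => ?_⟩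
  rw [Nat.card_divisors hy]
  push_cast
  have hyd : (y : ℝ) ^ δ = ∏ p ∈ y.primeFactors, ((p : ℝ) ^ δ) ^ (y.factorization p) := by
    conv_lhs => rw [← Nat.prod_factorization_pow_eq_self hy]
    rw [Finsupp.prod, Nat.support_factorization]
    push_cast
    rw [← Real.finsetProd_rpow _ _ (fun p _ => by positivity)]
    refine Finset.prod_congr rfl fun p _ => ?_
    rw [← Real.rpow_natCast, ← Real.rpow_natCast, ← Real.rpow_mul (by positivity),
      ← Real.rpow_mul (by positivity), mul_comm]
  have hterm : ∀ p ∈ y.primeFactors, ((y.factorization p : ℝ) + 1) ≤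
      (if p < P then C₀ else 1) * ((p : ℝ) ^ δ) ^ (y.factorization p) := by
    intro p hp
    have hp2 : (2 : ℝ) ≤ p := by exact_mod_cast (Nat.prime_of_mem_primeFactors hp).two_le
    set a := y.factorization p
    split_ifs with h
    · have h1 : (1 : ℝ) + a * (δ * Real.log 2) ≤ ((p : ℝ) ^ δ) ^ a := by
        calc (1 : ℝ) + a * (δ * Real.log 2) ≤ Real.exp (a * (δ * Real.log 2)) := by
              linarith [Real.add_one_le_exp ((a : ℝ) * (δ * Real.log 2))]
          _ = ((2 : ℝ) ^ δ) ^ a := by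
              rw [Real.rpow_def_of_pos (by norm_num), ← Real.exp_nat_mul, mul_comm δ]
          _ ≤ _ := by gcongr
      have h2 : 1 / (δ * Real.log 2) ≤ C₀ := le_max_right _ _
      have h3 : 1 ≤ C₀ * (δ * Real.log 2) := by
        rw [div_le_iff₀ (by positivity)] at h2
        exact h2
      have ha : (0 : ℝ) ≤ a := by positivity
      calc (a : ℝ) + 1 ≤ C₀ * (1 + a * (δ * Real.log 2)) := by nlinarith
        _ ≤ _ := by gcongr
    · rw [one_mul]
      have h1 : (2 : ℝ) ≤ (p : ℝ) ^ δ := by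
        have h2 : (2 : ℝ) ^ (1 / δ) ≤ p := hP.le.trans (by exact_mod_cast not_lt.mp h)
        calc (2 : ℝ) = ((2 : ℝ) ^ (1 / δ)) ^ δ := by
              rw [← Real.rpow_mul (by norm_num), one_div_mul_cancel hδ.ne', Real.rpow_one]
          _ ≤ _ := by gcongr
      calc (a : ℝ) + 1 ≤ 2 ^ a := by exact_mod_cast Nat.lt_two_pow_self
        _ ≤ _ := by gcongr
  calc ∏ p ∈ y.primeFactors, ((y.factorization p : ℝ) + 1)
      ≤ ∏ p ∈ y.primeFactors, ((if p < P then C₀ else 1) * ((p : ℝ) ^ δ) ^ (y.factorization p)) :=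
        Finset.prod_le_prod (fun _ _ => by positivity) hterm
    _ = (∏ p ∈ y.primeFactors, (if p < P then C₀ else 1)) * (y : ℝ) ^ δ := by
        rw [Finset.prod_mul_distrib, hyd]
    _ ≤ _ := by
        gcongr
        rw [Finset.prod_ite, Finset.prod_const, Finset.prod_const_one, mul_one]
        apply pow_le_pow_right₀ hC0
        calc _ ≤ (Finset.range P).card := Finset.card_le_card (fun p hp => by
              simp only [Finset.mem_filter] at hp
              exact Finset.mem_range.mpr hp.2)
          _ = P := Finset.card_range P

lemma prime_mem_dvd_absNorm (K : Type) [Field K] [NumberField K] (P : Ideal (𝓞 K)) (hP : P.IsPrime)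
    (p : ℕ) (hp : p.Prime) (h : (p : 𝓞 K) ∈ P) : p ∣ Ideal.absNorm P := by
  have h1 : Ideal.absNorm P ∣ p ^ Module.finrank ℚ K := by
    rw [← absNorm_natCast_span]
    exact Ideal.absNorm_dvd_absNorm_of_le ((Ideal.span_singleton_le_iff_mem _).mpr h)
  obtain ⟨k, hk, hk2⟩ := (Nat.dvd_prime_pow hp).mp h1
  rw [hk2]
  apply dvd_pow_self
  rintro rfl
  rw [pow_zero, Ideal.absNorm_eq_one_iff] at hk2
  exact hP.ne_top hk2

lemma exists_prime_mem (K : Type) [Field K] [NumberField K] (P : Ideal (𝓞 K)) (hP : P.IsPrime)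
    (y : ℕ) (hy : y ≠ 0) (h : (y : 𝓞 K) ∈ P) : ∃ p ∈ y.primeFactors, (p : 𝓞 K) ∈ P := by
  rw [← Nat.prod_factorization_pow_eq_self hy, Finsupp.prod, Nat.support_factorization, Nat.cast_prod,
    hP.prod_mem_iff] at h
  obtain ⟨p, hp, h⟩ := h
  refine ⟨p, hp, ?_⟩
  rw [Nat.cast_pow] at h
  exact hP.mem_of_pow_mem _ h

lemma ideal_count (K : Type) [Field K] [NumberField K] (y : ℕ) (hy : y ≠ 0)
    (S : Finset (Ideal (𝓞 K))) (hS : ∀ J ∈ S, Ideal.absNorm J = y) :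
    S.card ≤ y.divisors.card ^ Module.finrank ℚ K := by
  classical
  have hsy : Ideal.span {(y : 𝓞 K)} ≠ 0 := by
    rw [Ideal.zero_eq_bot, Ne, Ideal.span_singleton_eq_bot]
    exact_mod_cast hy
  let PP : Finset (Ideal (𝓞 K)) := (UniqueFactorizationMonoid.normalizedFactors (Ideal.span {(y : 𝓞 K)})).toFinset
  have hPPp : ∀ P ∈ PP, Prime P := fun P hP =>
    UniqueFactorizationMonoid.prime_of_normalized_factor P (Multiset.mem_toFinset.mp hP)
  have hPPprime : ∀ P ∈ PP, P.IsPrime := fun P hP => Ideal.isPrime_of_prime (hPPp P hP)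
  have hPPy : ∀ P ∈ PP, (y : 𝓞 K) ∈ P := fun P hP => by
    have := UniqueFactorizationMonoid.dvd_of_mem_normalizedFactors (Multiset.mem_toFinset.mp hP)
    exact (Ideal.span_singleton_le_iff_mem _).mp (Ideal.dvd_iff_le.mp this)
  have hpex : ∀ P : Ideal (𝓞 K), ∃ p : ℕ, P ∈ PP → p ∈ y.primeFactors ∧ (p : 𝓞 K) ∈ P := by
    intro P
    by_cases hP : P ∈ PP
    · obtain ⟨p, hp⟩ := exists_prime_mem K P (hPPprime P hP) y hy (hPPy P hP)
      exact ⟨p, fun _ => hp⟩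
    · exact ⟨0, fun h => absurd h hP⟩
  choose p hp using hpex
  let f : Ideal (𝓞 K) → (∀ P ∈ PP, ℕ) := fun J P _ =>
    (UniqueFactorizationMonoid.normalizedFactors J).count P
  have hJ0 : ∀ J ∈ S, J ≠ 0 := by
    rintro J hJ rfl
    have := hS _ hJ
    rw [Ideal.zero_eq_bot, Ideal.absNorm_bot] at this
    exact hy this.symm
  have hmaps : ∀ J ∈ S, f J ∈ PP.pi (fun P => Finset.range (y.factorization (p P) + 1)) := by
    intro J hJ
    rw [Finset.mem_pi]
    intro P hP
    rw [Finset.mem_range, Nat.lt_succ_iff]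
    have hpp := Nat.prime_of_mem_primeFactors (hp P hP).1
    rw [← hpp.pow_dvd_iff_le_factorization hy]
    have h1 : P ^ ((UniqueFactorizationMonoid.normalizedFactors J).count P) ∣ J := by
      rw [UniqueFactorizationMonoid.dvd_iff_normalizedFactors_le_normalizedFactors
        (pow_ne_zero _ (hPPp P hP).ne_zero) (hJ0 J hJ), UniqueFactorizationMonoid.normalizedFactors_pow,
        UniqueFactorizationMonoid.normalizedFactors_irreducible (hPPp P hP).irreducible, normalize_eq,
        Multiset.nsmul_singleton, ← Multiset.le_count_iff_replicate_le]
    have h2 := map_dvd Ideal.absNorm h1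
    rw [map_pow, hS J hJ] at h2
    exact (pow_dvd_pow_of_dvd (prime_mem_dvd_absNorm K P (hPPprime P hP) _ hpp (hp P hP).2) _).trans h2
  have hinj : Set.InjOn f S := by
    intro J hJ J' hJ' h
    have hsub : ∀ I ∈ S, ∀ P ∉ PP, (UniqueFactorizationMonoid.normalizedFactors I).count P = 0 := by
      intro I hI P hP
      rw [Multiset.count_eq_zero]
      intro hmem
      apply hP
      rw [Multiset.mem_toFinset]
      refine Multiset.mem_of_le ?_ hmem
      rw [← UniqueFactorizationMonoid.dvd_iff_normalizedFactors_le_normalizedFactors (hJ0 I hI) hsy,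
        Ideal.dvd_span_singleton, ← hS I hI]
      exact Ideal.absNorm_mem I
    have hfac : UniqueFactorizationMonoid.normalizedFactors J = UniqueFactorizationMonoid.normalizedFactors J' := by
      ext P
      by_cases hP : P ∈ PP
      · exact congrFun (congrFun h P) hP
      · rw [hsub J hJ P hP, hsub J' hJ' P hP]
    have h3 := UniqueFactorizationMonoid.prod_normalizedFactors_eq (hJ0 J hJ)
    have h4 := UniqueFactorizationMonoid.prod_normalizedFactors_eq (hJ0 J' hJ')
    rw [normalize_eq] at h3 h4
    rw [← h3, hfac, h4]
  have hcard := Finset.card_le_card_of_injOn f hmaps hinj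
  refine hcard.trans ?_
  rw [Finset.card_pi, Nat.card_divisors hy, ← Finset.prod_pow]
  simp only [Finset.card_range]
  rw [← Finset.prod_fiberwise_of_maps_to (s := PP) (t := y.primeFactors) (g := p) (fun P hP => (hp P hP).1)]
  refine Finset.prod_le_prod' fun q hq => ?_
  calc ∏ P ∈ PP.filter (fun P => p P = q), (y.factorization (p P) + 1)
      = ∏ P ∈ PP.filter (fun P => p P = q), (y.factorization q + 1) := by
        refine Finset.prod_congr rfl fun P hP => ?_
        rw [(Finset.mem_filter.mp hP).2]
    _ = (y.factorization q + 1) ^ (PP.filter (fun P => p P = q)).card := Finset.prod_const _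
    _ ≤ _ := by
        apply Nat.pow_le_pow_right (by omega)
        refine primes_over_card K q (Nat.prime_of_mem_primeFactors hq) _ ?_
        intro P hP
        obtain ⟨h5, h6⟩ := Finset.mem_filter.mp hP
        refine ⟨hPPprime P h5, ?_⟩
        rw [← h6]
        exact (hp P h5).2
end F1


section F2
open IntermediateField

lemma ideal_sq_mul_squarefree (L : Type) [Field L] [NumberField L] (N : ℕ) :
    ∀ I : Ideal (𝓞 L), I ≠ 0 → Ideal.absNorm I ≤ N → ∃ A b : Ideal (𝓞 L), I = A ^ 2 * b ∧ Squarefree b := by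
  induction N with
  | zero =>
    intro I hI h
    exfalso
    apply hI
    rw [Ideal.zero_eq_bot, ← Ideal.absNorm_eq_zero_iff]
    omega
  | succ N ih =>
    intro I hI h
    by_cases hs : Squarefree I
    · exact ⟨1, I, by rw [one_pow, one_mul], hs⟩
    · simp only [Squarefree, not_forall] at hs
      obtain ⟨x, ⟨I', hI'⟩, hx⟩ := hs
      have hI0 : I' ≠ 0 := by rintro rfl; simp at hI'; exact hI hI'
      have hx0 : x ≠ 0 := by rintro rfl; simp at hI'; exact hI hI'
      have hlt : Ideal.absNorm I' ≤ N := by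
        have h1 : Ideal.absNorm I = Ideal.absNorm x * Ideal.absNorm x * Ideal.absNorm I' := by
          rw [hI', map_mul, map_mul]
        have h2 : Ideal.absNorm x ≠ 0 := by
          rw [Ne, Ideal.absNorm_eq_zero_iff]; exact hx0
        have h3 : Ideal.absNorm x ≠ 1 := by
          rw [Ne, Ideal.absNorm_eq_one_iff]
          intro h; exact hx (by rw [Ideal.isUnit_iff]; exact h)
        have h4 : Ideal.absNorm I' ≠ 0 := by
          rw [Ne, Ideal.absNorm_eq_zero_iff]; exact hI0
        have h5 : 2 ≤ Ideal.absNorm x := by omega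
        have h6 : 4 ≤ Ideal.absNorm x * Ideal.absNorm x := by nlinarith
        have h7 : 4 * Ideal.absNorm I' ≤ Ideal.absNorm I := by rw [h1]; gcongr
        omega
      obtain ⟨A, b, hAb, hb⟩ := ih I' hI0 hlt
      exact ⟨x * A, b, by rw [hI', hAb]; ring, hb⟩

lemma exists_prime_dvd_of_dvd_absNorm (L : Type) [Field L] [NumberField L] (b : Ideal (𝓞 L)) (hb : b ≠ 0)
    (p : ℕ) (hp : p.Prime) (h : p ∣ Ideal.absNorm b) :
    ∃ P : Ideal (𝓞 L), Prime P ∧ P ∣ b ∧ (p : 𝓞 L) ∈ P := by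
  classical
  have h1 := UniqueFactorizationMonoid.prod_normalizedFactors_eq hb
  rw [normalize_eq] at h1
  rw [← h1, map_multiset_prod] at h
  obtain ⟨P, hP, hd⟩ := hp.prime.exists_mem_multiset_map_dvd h
  have hPp := UniqueFactorizationMonoid.prime_of_normalized_factor P hP
  refine ⟨P, hPp, UniqueFactorizationMonoid.dvd_of_mem_normalizedFactors hP, ?_⟩
  have hPi := Ideal.isPrime_of_prime hPp
  have hN : Ideal.absNorm P ≠ 0 := by
    rw [Ne, Ideal.absNorm_eq_zero_iff]; exact hPp.ne_zero
  obtain ⟨p', hp', hm⟩ := exists_prime_mem L P hPi _ hN (Ideal.absNorm_mem P)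
  have hpp' := Nat.prime_of_mem_primeFactors hp'
  have h2 : Ideal.absNorm P ∣ p' ^ Module.finrank ℚ L := by
    rw [← absNorm_natCast_span]
    exact Ideal.absNorm_dvd_absNorm_of_le ((Ideal.span_singleton_le_iff_mem _).mpr hm)
  have h3 : p = p' := (Nat.prime_dvd_prime_iff_eq hp hpp').mp (hp.dvd_of_dvd_pow (hd.trans h2))
  rw [h3]
  exact hm

lemma dvd_discr_of_sq_dvd (K : Type) [Field K] [NumberField K] (P : Ideal (𝓞 K)) (hP : Prime P) (p : ℕ)
    (hp : p.Prime) (h : P ^ 2 ∣ Ideal.span {(p : 𝓞 K)}) : p ∣ (discr K).natAbs := by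
  have hPi := Ideal.isPrime_of_prime hP
  have hpi : Prime (p : ℤ) := Nat.prime_iff_prime_int.mp hp
  have hmax : (Ideal.span {(p : ℤ)}).IsMaximal :=
    PrincipalIdealRing.isMaximal_of_irreducible hpi.irreducible
  have h1 : P ^ (2 - 1) ∣ differentIdeal ℤ (𝓞 K) := by
    refine pow_sub_one_dvd_differentIdeal ℤ (p := Ideal.span {(p : ℤ)}) P 2 ?_ ?_
    · rw [Ne, Ideal.span_singleton_eq_bot]; exact hpi.ne_zero
    · rw [Ideal.map_span, Set.image_singleton]
      simpa using h
  rw [show 2 - 1 = 1 from rfl, pow_one] at h1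
  have h2 := map_dvd Ideal.absNorm h1
  rw [absNorm_differentIdeal K] at h2
  refine (prime_mem_dvd_absNorm K P hPi p hp ?_).trans h2
  have h3 := (dvd_pow_self P two_ne_zero).trans h
  exact (Ideal.dvd_span_singleton).mp h3

lemma ramified_of_sq (L K : Type) [Field L] [NumberField L] [Field K] [NumberField K] [Algebra L K]
    (x : 𝓞 L) (hx : x ≠ 0) (J : Ideal (𝓞 K)) (hJ : J ^ 2 = Ideal.span {algebraMap (𝓞 L) (𝓞 K) x})
    (A b : Ideal (𝓞 L)) (hAb : Ideal.span {x} = A ^ 2 * b) (hb : Squarefree b)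
    (p : ℕ) (hp : p.Prime) (hpb : p ∣ Ideal.absNorm b) : p ∣ (discr K).natAbs := by
  have hsx : Ideal.span {x} ≠ 0 := by
    rw [Ideal.zero_eq_bot, Ne, Ideal.span_singleton_eq_bot]; exact hx
  have hA0 : A ≠ 0 := by rintro rfl; simp at hAb; exact hx hAb
  have hb0 : b ≠ 0 := by rintro rfl; simp at hAb; exact hx hAb
  obtain ⟨q, hq, hqb, hpq⟩ := exists_prime_dvd_of_dvd_absNorm L b hb0 p hp hpb
  obtain ⟨c, rfl⟩ := hqb
  have hqc : ¬ q ∣ c := by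
    intro h
    have := hb q (mul_dvd_mul_left q h)
    exact hq.not_unit this
  have hinj : Function.Injective (algebraMap (𝓞 L) (𝓞 K)) := FaithfulSMul.algebraMap_injective _ _
  set φ := algebraMap (𝓞 L) (𝓞 K)
  have hmap : J ^ 2 = (A.map φ) ^ 2 * (q.map φ * c.map φ) := by
    rw [← Ideal.map_mul, ← Ideal.map_pow, ← Ideal.map_mul, ← hAb, Ideal.map_span, Set.image_singleton, hJ]
  have hAm : A.map φ ≠ 0 := by
    rw [Ideal.zero_eq_bot, Ne, Ideal.map_eq_bot_iff_of_injective hinj]; exact hA0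
  have hAJ : A.map φ ∣ J := by
    rw [← UniqueFactorizationMonoid.pow_dvd_pow_iff_dvd two_ne_zero, hmap]
    exact dvd_mul_right _ _
  obtain ⟨J', rfl⟩ := hAJ
  rw [mul_pow] at hmap
  have hJ' := mul_left_cancel₀ (pow_ne_zero 2 hAm) hmap
  have hqi := Ideal.isPrime_of_prime hq
  have hqmax : q.IsMaximal := hqi.isMaximal hq.ne_zero
  obtain ⟨P, hPmax, hPq⟩ := Ideal.exists_maximal_ideal_liesOver_of_isIntegral (S := 𝓞 K) q
  have hPle : q.map φ ≤ P := Ideal.map_le_iff_le_comap.mpr hPq.over.le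
  have hPbot : P ≠ ⊥ := by
    rintro rfl
    rw [le_bot_iff, Ideal.map_eq_bot_iff_of_injective hinj] at hPle
    exact hq.ne_zero hPle
  have hP : Prime P := Ideal.prime_of_isPrime hPbot hPmax.isPrime
  have hPc : ¬ P ∣ c.map φ := by
    intro h
    rw [Ideal.dvd_iff_le, Ideal.map_le_iff_le_comap] at h
    apply hqc
    rw [Ideal.dvd_iff_le]
    exact h.trans hPq.over.ge
  have hPJ : P ∣ J' := by
    apply hP.dvd_of_dvd_pow (n := 2)
    rw [hJ']
    exact (Ideal.dvd_iff_le.mpr hPle).mul_right _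
  have hP2 : P ^ 2 ∣ q.map φ * c.map φ := by
    rw [← hJ']
    exact pow_dvd_pow_of_dvd hPJ 2
  have hP3 : P ^ 2 ∣ q.map φ := hP.pow_dvd_of_dvd_mul_right 2 hPc hP2
  refine dvd_discr_of_sq_dvd K P hP p hp (hP3.trans ?_)
  rw [Ideal.dvd_span_singleton]
  have := Ideal.mem_map_of_mem φ hpq
  rwa [map_natCast] at this

lemma bad_structure (K : Type) [Field K] [NumberField K] (α : 𝓞 K) (hα : α ≠ 0) (J : Ideal (𝓞 K))
    (hJ : J ^ 2 = Ideal.span {α}) (h : ℚ⟮(α : K)⟯ ≠ ⊤) :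
    ∃ k a b : ℕ, 2 ≤ k ∧ k ≤ Module.finrank ℚ K ∧ a ≠ 0 ∧ b ≠ 0 ∧ b ∣ (discr K).natAbs ∧
      Ideal.absNorm J ^ 2 = (a ^ 2 * b) ^ k := by
  let L := ℚ⟮(α : K)⟯
  let x : 𝓞 L := ⟨AdjoinSimple.gen ℚ (α : K), by
    have h1 : IsIntegral ℤ (algebraMap L K (AdjoinSimple.gen ℚ (α : K))) := by
      rw [AdjoinSimple.algebraMap_gen]
      exact RingOfIntegers.isIntegral_coe α
    exact (isIntegral_algebraMap_iff (algebraMap L K).injective).mp h1⟩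
  have hxα : algebraMap (𝓞 L) (𝓞 K) x = α := by
    apply RingOfIntegers.coe_injective
    exact AdjoinSimple.algebraMap_gen ℚ (α : K)
  have hx : x ≠ 0 := by
    rintro h0
    rw [h0, map_zero] at hxα
    exact hα hxα.symm
  have hsx : Ideal.span {x} ≠ 0 := by
    rw [Ideal.zero_eq_bot, Ne, Ideal.span_singleton_eq_bot]; exact hx
  obtain ⟨A, b, hAb, hb⟩ := ideal_sq_mul_squarefree L _ (Ideal.span {x}) hsx le_rfl
  obtain ⟨b₀, c, hcb, hsq⟩ := Nat.sq_mul_squarefree (Ideal.absNorm b)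
  have hA0 : A ≠ 0 := by rintro rfl; simp at hAb; exact hx hAb
  have hb0 : b ≠ 0 := by rintro rfl; simp at hAb; exact hx hAb
  have hNA : Ideal.absNorm A ≠ 0 := by
    rw [Ne, Ideal.absNorm_eq_zero_iff]; exact hA0
  have hNb : Ideal.absNorm b ≠ 0 := by
    rw [Ne, Ideal.absNorm_eq_zero_iff]; exact hb0
  have hc0 : c ≠ 0 := by rintro rfl; apply hNb; rw [← hcb]; simp
  refine ⟨Module.finrank L K, Ideal.absNorm A * c, b₀, ?_, ?_, mul_ne_zero hNA hc0, hsq.ne_zero, ?_, ?_⟩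
  · have h1 : 0 < Module.finrank L K := Module.finrank_pos
    have h2 : Module.finrank L K ≠ 1 := by
      intro h2
      exact h (IntermediateField.finrank_eq_one_iff_eq_top.mp h2)
    omega
  · have h1 := Module.finrank_mul_finrank ℚ L K
    have h2 : 0 < Module.finrank ℚ L := Module.finrank_pos
    rw [← h1]
    exact Nat.le_mul_of_pos_left _ h2
  · rw [← Nat.prod_primeFactors_of_squarefree hsq]
    refine Finset.prod_primes_dvd _ (fun p hp => (Nat.prime_of_mem_primeFactors hp).prime) ?_
    intro p hp
    refine ramified_of_sq L K x hx J (by rw [hxα, hJ]) A b hAb hb p (Nat.prime_of_mem_primeFactors hp) ?_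
    rw [← hcb]
    exact (Nat.dvd_of_mem_primeFactors hp).mul_left _
  · have h1 := Ideal.absNorm_algebraMap (𝓞 L) (S := 𝓞 K) (Ideal.span {x})
    rw [Ideal.map_span, Set.image_singleton, hxα, ← hJ, map_pow, hAb, map_mul, map_pow, ← hcb] at h1
    rw [h1, IsFractionRing.finrank_eq (𝓞 L) L (𝓞 K) K]
    congr 1
    ring
end F2


section F3
open IntermediateField

lemma bad_count (n : ℕ) (hn : 1 ≤ n) :
    ∃ C : ℝ, 0 < C ∧ ∀ (K : Type) [Field K] [NumberField K], Module.finrank ℚ K = n →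
      ∀ S : Finset (Ideal (𝓞 K)), (∀ J ∈ S, ∃ α : 𝓞 K, α ≠ 0 ∧ J ^ 2 = Ideal.span {α} ∧
        (∀ w : InfinitePlace K, w (α : K) ≤ boxR K) ∧ ℚ⟮(α : K)⟯ ≠ ⊤) →
      (S.card : ℝ) ≤ C * |(discr K : ℝ)| ^ ((11 : ℝ) / 30) := by
  classical
  have hn0 : (0 : ℝ) < n := by exact_mod_cast hn
  obtain ⟨C₁, hC₁, h₁⟩ := divisor_bound (1 / (30 * n)) (by positivity)
  obtain ⟨C₂, hC₂, h₂⟩ := divisor_bound (1 / 60) (by positivity)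
  refine ⟨(C₁ ^ n * (2 * (n + 1) * C₂)) * ((4 : ℝ) ^ (n + 1)) ^ ((11 : ℝ) / 30), by positivity, ?_⟩
  intro K _ _ hK S hS
  set D := |(discr K : ℝ)| with hD
  have hD1 : 1 ≤ D := one_le_abs_discr K
  set Z : ℝ := 4 ^ (n + 1) * D with hZ
  have hBn := boxR_pow K
  rw [hK, ← hD, ← hZ] at hBn
  have hDZ : D ≤ Z := le_mul_of_one_le_left (by linarith) (one_le_pow₀ (by norm_num))
  have hZ1 : 1 ≤ Z := hD1.trans hDZ
  have hZ0 : 0 < Z := by linarith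
  have hdisc : (discr K).natAbs ≠ 0 := by
    rw [Int.natAbs_ne_zero]
    exact discr_ne_zero K
  have hdiscD : ((discr K).natAbs : ℝ) = D := by
    rw [hD, Nat.cast_natAbs, Int.cast_abs]
  have hJ : ∀ J ∈ S, J ≠ 0 ∧ ((Ideal.absNorm J : ℝ)) ^ 2 ≤ Z ∧ ∃ t : ℕ × ℕ × ℕ,
      t ∈ Finset.range (n + 1) ×ˢ Finset.range (⌊Z ^ ((1 : ℝ) / 4)⌋₊ + 1) ×ˢ (discr K).natAbs.divisors ∧
      Ideal.absNorm J ^ 2 = (t.2.1 ^ 2 * t.2.2) ^ t.1 := by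
    intro J hJS
    obtain ⟨α, hα, hJα, hbox, hbad⟩ := hS J hJS
    have hJ0 : J ≠ 0 := by
      rintro rfl
      rw [zero_pow two_ne_zero, eq_comm, Ideal.zero_eq_bot, Ideal.span_singleton_eq_bot] at hJα
      exact hα hJα
    have hNZ : ((Ideal.absNorm J : ℝ)) ^ 2 ≤ Z := by
      have := absNorm_le_pow K α (boxR K) hbox
      rw [← hJα, map_pow, hK, hBn] at this
      exact_mod_cast this
    refine ⟨hJ0, hNZ, ?_⟩
    obtain ⟨k, a, b, hk2, hkn, ha, hb, hbd, heq⟩ := bad_structure K α hα J hJα hbad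
    refine ⟨(k, a, b), ?_, heq⟩
    simp only [Finset.mem_product, Finset.mem_range, Nat.mem_divisors]
    refine ⟨by omega, ?_, hbd, hdisc⟩
    rw [Nat.lt_succ_iff]
    apply Nat.le_floor
    have h4 : a ^ 4 ≤ (a ^ 2 * b) ^ k := by
      calc a ^ 4 = (a ^ 2) ^ 2 := by ring
        _ ≤ (a ^ 2) ^ k := Nat.pow_le_pow_right (by positivity) hk2
        _ ≤ _ := Nat.pow_le_pow_left (Nat.le_mul_of_pos_right _ (Nat.pos_of_ne_zero hb)) _
    have h5 : (a : ℝ) ^ 4 ≤ Z := by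
      refine le_trans ?_ hNZ
      rw [← heq] at h4
      exact_mod_cast h4
    calc (a : ℝ) = ((a : ℝ) ^ 4) ^ ((1 : ℝ) / 4) := by
          rw [one_div]
          exact (Real.pow_rpow_inv_natCast (n := 4) (by positivity) (by norm_num)).symm
      _ ≤ _ := by gcongr
  have hex : ∀ J : Ideal (𝓞 K), ∃ t : ℕ × ℕ × ℕ, J ∈ S →
      (t ∈ Finset.range (n + 1) ×ˢ Finset.range (⌊Z ^ ((1 : ℝ) / 4)⌋₊ + 1) ×ˢ (discr K).natAbs.divisors ∧
      Ideal.absNorm J ^ 2 = (t.2.1 ^ 2 * t.2.2) ^ t.1) := by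
    intro J
    by_cases h : J ∈ S
    · obtain ⟨-, -, t, ht⟩ := hJ J h
      exact ⟨t, fun _ => ht⟩
    · exact ⟨0, fun h' => absurd h' h⟩
  choose t ht using hex
  have hmain := Finset.card_le_mul_card_image_of_maps_to (s := S) (f := t)
    (t := Finset.range (n + 1) ×ˢ Finset.range (⌊Z ^ ((1 : ℝ) / 4)⌋₊ + 1) ×ˢ (discr K).natAbs.divisors)
    (fun J hJS => (ht J hJS).1) ⌊C₁ ^ n * Z ^ ((1 : ℝ) / 60)⌋₊ (by
      intro τ _
      by_cases hemp : (S.filter (fun J => t J = τ)).Nonempty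
      swap
      · rw [Finset.not_nonempty_iff_eq_empty] at hemp
        rw [hemp]
        simp
      obtain ⟨J₀, hJ₀⟩ := hemp
      obtain ⟨hJ₀S, hJ₀τ⟩ := Finset.mem_filter.mp hJ₀
      set y := Ideal.absNorm J₀ with hy
      have hy0 : y ≠ 0 := by
        rw [hy, Ne, Ideal.absNorm_eq_zero_iff]
        exact (hJ J₀ hJ₀S).1
      have hcnt := ideal_count K y hy0 (S.filter (fun J => t J = τ)) (by
        intro J hJf
        obtain ⟨hJS, hJτ⟩ := Finset.mem_filter.mp hJf
        have e1 := (ht J hJS).2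
        have e2 := (ht J₀ hJ₀S).2
        rw [hJτ] at e1
        rw [hJ₀τ, ← e1] at e2
        exact (Nat.pow_left_injective two_ne_zero e2).symm)
      rw [hK] at hcnt
      apply Nat.le_floor
      have hyZ : (y : ℝ) ^ 2 ≤ Z := (hJ J₀ hJ₀S).2.1
      calc ((S.filter (fun J => t J = τ)).card : ℝ) ≤ (y.divisors.card : ℝ) ^ n := by exact_mod_cast hcnt
        _ ≤ (C₁ * (y : ℝ) ^ ((1 : ℝ) / (30 * n))) ^ n := by gcongr; exact h₁ y hy0
        _ = C₁ ^ n * ((y : ℝ) ^ 2) ^ ((1 : ℝ) / 60) := by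
            rw [mul_pow, ← Real.rpow_natCast ((y : ℝ) ^ _), ← Real.rpow_natCast (y : ℝ) 2,
              ← Real.rpow_mul (by positivity), ← Real.rpow_mul (by positivity)]
            congr 2
            push_cast
            field_simp
            norm_num
        _ ≤ _ := by gcongr)
  rw [Finset.card_product, Finset.card_product, Finset.card_range, Finset.card_range] at hmain
  have hmain' : (S.card : ℝ) ≤ (⌊C₁ ^ n * Z ^ ((1 : ℝ) / 60)⌋₊ : ℝ) *
      (((n : ℝ) + 1) * (((⌊Z ^ ((1 : ℝ) / 4)⌋₊ : ℝ) + 1) * ((discr K).natAbs.divisors.card : ℝ))) := by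
    exact_mod_cast hmain
  have hf1 : (⌊C₁ ^ n * Z ^ ((1 : ℝ) / 60)⌋₊ : ℝ) ≤ C₁ ^ n * Z ^ ((1 : ℝ) / 60) :=
    Nat.floor_le (by positivity)
  have hf2 : (⌊Z ^ ((1 : ℝ) / 4)⌋₊ : ℝ) + 1 ≤ 2 * Z ^ ((1 : ℝ) / 4) := by
    have e1 : (⌊Z ^ ((1 : ℝ) / 4)⌋₊ : ℝ) ≤ Z ^ ((1 : ℝ) / 4) := Nat.floor_le (by positivity)
    have e2 : 1 ≤ Z ^ ((1 : ℝ) / 4) := Real.one_le_rpow hZ1 (by norm_num)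
    linarith
  have hf3 : ((discr K).natAbs.divisors.card : ℝ) ≤ C₂ * Z ^ ((1 : ℝ) / 60) := by
    refine (h₂ _ hdisc).trans ?_
    rw [hdiscD]
    gcongr
  calc (S.card : ℝ) ≤ _ := hmain'
    _ ≤ (C₁ ^ n * Z ^ ((1 : ℝ) / 60)) * (((n : ℝ) + 1) * ((2 * Z ^ ((1 : ℝ) / 4)) * (C₂ * Z ^ ((1 : ℝ) / 60)))) := by
        gcongr
    _ = (C₁ ^ n * (2 * (n + 1) * C₂)) * (Z ^ ((1 : ℝ) / 60) * Z ^ ((1 : ℝ) / 4) * Z ^ ((1 : ℝ) / 60)) := by ring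
    _ = (C₁ ^ n * (2 * (n + 1) * C₂)) * Z ^ ((17 : ℝ) / 60) := by
        rw [← Real.rpow_add hZ0, ← Real.rpow_add hZ0]
        norm_num
    _ ≤ (C₁ ^ n * (2 * (n + 1) * C₂)) * Z ^ ((11 : ℝ) / 30) := by
        have e5 : Z ^ ((17 : ℝ) / 60) ≤ Z ^ ((11 : ℝ) / 30) :=
          Real.rpow_le_rpow_of_exponent_le hZ1 (by norm_num)
        gcongr
    _ = _ := by
        rw [hZ, Real.mul_rpow (by positivity) (by linarith)]
        ring
end F3

section Main
open IntermediateField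

lemma total_count (F : Type) [Field F] [NumberField F] (hF : 2 ≤ Module.finrank ℚ F) (n : ℕ) (hn : 5 ≤ n) :
    ∃ C : ℝ, 0 < C ∧ ∀ (K : Type) [Field K] [NumberField K] [Algebra F K], Module.finrank ℚ K = n →
      (Nat.card {c : ClassGroup (𝓞 K) // c ^ 2 = 1} : ℝ) ≤
        C * |(discr K : ℝ)| ^ ((1 : ℝ) / 2 - 2 / (3 * (n : ℝ))) := by
  classical
  obtain ⟨C₁, hC₁, h₁⟩ := good_count F hF n (by omega)
  obtain ⟨C₂, hC₂, h₂⟩ := bad_count n (by omega)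
  refine ⟨C₁ + C₂, by positivity, ?_⟩
  intro K _ _ _ hK
  have hrep := fun c : {c : ClassGroup (𝓞 K) // c ^ 2 = 1} => exists_rep K c.1 c.2
  choose J α hJc hα hJα hbox using hrep
  have : Fintype {c : ClassGroup (𝓞 K) // c ^ 2 = 1} := Fintype.ofFinite _
  rw [Nat.card_eq_fintype_card, ← Finset.card_univ,
    ← Finset.card_filter_add_card_filter_not (fun c => F⟮(α c : K)⟯ = ⊤)]
  have hJinj : Function.Injective (fun c => (J c : Ideal (𝓞 K))) := by
    intro c c' h
    apply Subtype.ext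
    rw [← hJc c, ← hJc c']
    exact congrArg _ (Subtype.ext h)
  have hαinj : Function.Injective α := by
    intro c c' h
    apply hJinj
    have h1 : (J c : Ideal (𝓞 K)) ^ 2 = (J c' : Ideal (𝓞 K)) ^ 2 := by rw [hJα, hJα, h]
    apply dvd_antisymm
    · rw [← UniqueFactorizationMonoid.pow_dvd_pow_iff_dvd two_ne_zero, h1]
    · rw [← UniqueFactorizationMonoid.pow_dvd_pow_iff_dvd two_ne_zero, h1]
  have hD1 := one_le_abs_discr K
  set D := |(discr K : ℝ)|
  have hg : ((Finset.univ.filter (fun c => F⟮(α c : K)⟯ = ⊤)).card : ℝ) ≤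
      C₁ * D ^ ((1 : ℝ) / 2 - 2 / (3 * (n : ℝ))) := by
    rw [← Finset.card_image_of_injective _ hαinj]
    refine h₁ K hK _ ?_
    intro x hx
    obtain ⟨c, hc, rfl⟩ := Finset.mem_image.mp hx
    exact ⟨hα c, (Finset.mem_filter.mp hc).2, ⟨_, hJα c⟩, hbox c⟩
  have hb : ((Finset.univ.filter (fun c => ¬ F⟮(α c : K)⟯ = ⊤)).card : ℝ) ≤
      C₂ * D ^ ((1 : ℝ) / 2 - 2 / (3 * (n : ℝ))) := by
    rw [← Finset.card_image_of_injective _ hJinj]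
    refine (h₂ K hK _ ?_).trans ?_
    · intro I hI
      obtain ⟨c, hc, rfl⟩ := Finset.mem_image.mp hI
      refine ⟨α c, hα c, hJα c, hbox c, ?_⟩
      intro htop
      exact (Finset.mem_filter.mp hc).2 (IntermediateField.adjoin_eq_top_of_adjoin_eq_top ℚ htop)
    · gcongr
      · have h5 : (5 : ℝ) ≤ n := by exact_mod_cast hn
        have h6 : 2 / (3 * (n : ℝ)) ≤ 2 / (3 * 5) := by gcongr
        linarith
  push_cast
  linarith
end Main

theorem stmt5 (F : Type) [Field F] [NumberField F] (hF : 2 ≤ Module.finrank ℚ F)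
    (n : ℕ) (hn : 5 ≤ n) (ε : ℝ) (hε : 0 < ε) :
    ∃ C : ℝ, 0 < C ∧
      ∀ (K : Type) [Field K] [NumberField K],
        Module.finrank ℚ K = n →
        Nonempty (F →ₐ[ℚ] K) →
        (Nat.card {c : ClassGroup (𝓞 K) // c ^ 2 = 1} : ℝ) ≤
          C * (|discr K| : ℝ) ^ ((1 : ℝ) / 2 - 2 / (3 * (n : ℝ)) + ε) := by
  obtain ⟨C, hC, h⟩ := total_count F hF n hn
  refine ⟨C, hC, ?_⟩
  intro K _ _ hK hne
  obtain ⟨f⟩ := hne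
  let _ : Algebra F K := f.toRingHom.toAlgebra
  refine (h K hK).trans ?_
  have hD1 := one_le_abs_discr K
  gcongr
  linarith
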